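/- arXiv:1811.01851 — 3 statements merged into one kernel-verified Lean document; each statement's English description precedes it below -/
import Mathlib

section
/- Let p be a prime with p > 2, let d, r, N be positive integers, let W = ⋀²(F_p^d) and set ρ = binom(d,2) − r. Suppose ρ ≥ 3, d > 4N, r > 3N and ρ > 3N + 1. For a subspace L ≤ W, let L^∧ denote the span of the decomposable elements of W contained in L. Then the number of r-dimensional subspaces L ≤ W with dim(L/L^∧) ≥ N is at least p^{(r−3N)(ρ−3N−1)}. In particular, if ρ ≥ 3, d > 4, r > 3 and ρ > 4, then the number of r-dimensional subspaces of W that are not spanned by decomposables is at least p^{(r−3)(ρ−4)}. -/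
open Module Filter

noncomputable section

variable (K : Type*) [CommRing K] (V : Type*) [AddCommGroup V] [Module K V]

/-- The set of decomposable elements of the exterior square, viewed inside the
exterior algebra: elements of the form `v ∧ w`. -/
def DecompSet : Set (ExteriorAlgebra K V) :=
  {x | ∃ v w : V, x = ExteriorAlgebra.ι K v * ExteriorAlgebra.ι K w}

/-- The second exterior power `⋀² V`, realised as the span of all decomposable
wedges inside the exterior algebra. -/
def grade2 : Submodule K (ExteriorAlgebra K V) := Submodule.span K (DecompSet K V)

/-- A subspace `L ≤ ⋀² V` is spanned by decomposables if it equals the span of the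
set of decomposable elements contained in it. -/
def SpannedByDecomposables (L : Submodule K (ExteriorAlgebra K V)) : Prop :=
  L = Submodule.span K ((L : Set (ExteriorAlgebra K V)) ∩ DecompSet K V)

/-- The number of `r`-dimensional subspaces of `⋀²(F_p^d)` that are spanned by
decomposables. -/
def numSpanned (p d r : ℕ) : ℕ :=
  Nat.card {L : Submodule (ZMod p) (ExteriorAlgebra (ZMod p) (Fin d → ZMod p)) //
    L ≤ grade2 (ZMod p) (Fin d → ZMod p) ∧ finrank (ZMod p) L = r ∧
    SpannedByDecomposables (ZMod p) (Fin d → ZMod p) L}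

/-- The number of all `r`-dimensional subspaces of `⋀²(F_p^d)`. -/
def numAll (p d r : ℕ) : ℕ :=
  Nat.card {L : Submodule (ZMod p) (ExteriorAlgebra (ZMod p) (Fin d → ZMod p)) //
    L ≤ grade2 (ZMod p) (Fin d → ZMod p) ∧ finrank (ZMod p) L = r}

/-- The proportion of `r`-dimensional subspaces of `⋀²(F_p^d)` that are spanned
by decomposables. -/
def decompRatio (p d r : ℕ) : ℝ := (numSpanned p d r : ℝ) / (numAll p d r : ℝ)

/-- The filter of primes tending to infinity. -/
def primesAtTop : Filter ℕ := atTop ⊓ 𝓟 {p : ℕ | p.Prime}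

/-- For a subspace `L` of `⋀² V`, the subspace `L^∧` spanned by the decomposable
elements of `⋀² V` contained in `L`. -/
def wedgePart (L : Submodule K (ExteriorAlgebra K V)) : Submodule K (ExteriorAlgebra K V) :=
  Submodule.span K ((L : Set (ExteriorAlgebra K V)) ∩ DecompSet K V)

section LinearAlgebra

variable {F U T E : Type*} [Field F] [AddCommGroup U] [Module F U] [AddCommGroup T] [Module F T]
  [AddCommGroup E] [Module F E]

theorem LinearMap.finrank_ker_of_surjective [FiniteDimensional F U] (f : U →ₗ[F] T)
    (hf : Function.Surjective f) : finrank F (LinearMap.ker f) + finrank F T = finrank F U := by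
  rw [← f.finrank_range_add_finrank_ker, LinearMap.range_eq_top.2 hf, finrank_top, add_comm]

/-- A surjection `f : U → T` whose kernel has dimension `k + c` is, up to isomorphism,
the first projection of `T × (F^k × F^c)`. -/
theorem LinearMap.exists_equiv_prod_of_surjective [FiniteDimensional F U] [FiniteDimensional F T]
    (f : U →ₗ[F] T) (hf : Function.Surjective f) {k c : ℕ}
    (hU : finrank F U = finrank F T + (k + c)) :
    ∃ e : U ≃ₗ[F] T × ((Fin k → F) × (Fin c → F)), ∀ u, (e u).1 = f u := by
  have hker := f.finrank_ker_of_surjective hf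
  obtain ⟨j⟩ : Nonempty (LinearMap.ker f ≃ₗ[F] (Fin k → F) × (Fin c → F)) :=
    FiniteDimensional.nonempty_linearEquiv_of_finrank_eq (by simp; omega)
  obtain ⟨π, hπ⟩ := (LinearMap.ker f).subtype.exists_leftInverse_of_injective
    (Submodule.ker_subtype _)
  have hinj : Function.Injective (f.prod (j.toLinearMap ∘ₗ π)) := by
    rw [← LinearMap.ker_eq_bot, LinearMap.ker_eq_bot']
    intro u hu
    have h₁ : f u = 0 := congrArg Prod.fst hu
    have h₂ : π u = 0 := j.map_eq_zero_iff.1 (congrArg Prod.snd hu)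
    have h₃ : π u = ⟨u, h₁⟩ := LinearMap.congr_fun hπ ⟨u, h₁⟩
    exact congrArg Subtype.val (h₃.symm.trans h₂)
  exact ⟨LinearEquiv.ofInjectiveOfFinrankEq _ hinj (by simp [hU]), fun u => rfl⟩

/-- The family of subspaces indexed by `φ : F^k → F^c`, each of codimension `c` and each
surjecting onto `T` under `f`. -/
theorem LinearMap.exists_injective_family_of_surjective [FiniteDimensional F U]
    [FiniteDimensional F T]
    (f : U →ₗ[F] T) (hf : Function.Surjective f) {k c : ℕ}
    (hU : finrank F U = finrank F T + (k + c)) :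
    ∃ L : ((Fin k → F) →ₗ[F] (Fin c → F)) → Submodule F U, Function.Injective L ∧
      ∀ φ, finrank F (L φ) = finrank F T + k ∧
        finrank F (L φ ⊓ LinearMap.ker f : Submodule F U) = k := by
  obtain ⟨e, he⟩ := f.exists_equiv_prod_of_surjective hf hU
  let ψ (φ : (Fin k → F) →ₗ[F] (Fin c → F)) : U →ₗ[F] (Fin c → F) :=
    (LinearMap.snd F _ _ - φ ∘ₗ LinearMap.fst F _ _) ∘ₗ LinearMap.snd F _ _ ∘ₗ e.toLinearMap
  have hψ (φ u) : ψ φ u = (e u).2.2 - φ (e u).2.1 := rfl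
  refine ⟨fun φ => LinearMap.ker (ψ φ), fun φ φ' h => ?_, fun φ => ⟨?_, ?_⟩⟩
  · refine LinearMap.ext fun x => ?_
    have hx : e.symm (0, (x, φ x)) ∈ LinearMap.ker (ψ φ) := by simp [hψ]
    have hx' : e.symm (0, (x, φ x)) ∈ LinearMap.ker (ψ φ') :=
      (show LinearMap.ker (ψ φ) = LinearMap.ker (ψ φ') from h) ▸ hx
    simpa [hψ, sub_eq_zero] using hx'
  · have := (ψ φ).finrank_ker_of_surjective fun y => ⟨e.symm (0, (0, y)), by simp [hψ]⟩
    simp only [finrank_fin_fun] at this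
    change finrank F (LinearMap.ker (ψ φ)) = _
    omega
  · rw [← LinearMap.ker_prod]
    have := ((ψ φ).prod f).finrank_ker_of_surjective fun y =>
      ⟨e.symm (y.2, (0, y.1)), by ext1 <;> simp [hψ, ← he]⟩
    simp at this
    omega

/-- If every element of `S` in `W ∩ ker H` is killed by `f`, where `(H, f)` is jointly surjective
on `W`, there are at least `|F|^{kc}` subspaces of `W` in which `S` spans a subspace of codimension
at least `dim T`. -/
theorem card_pow_le_card_submodule_span_inter {T' : Type*} [AddCommGroup T'] [Module F T']
    [Finite F] [Finite E] [FiniteDimensional F T]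
    (W : Submodule F E) (H : E →ₗ[F] T') (f : E →ₗ[F] T)
    (hHf : ∀ z y, ∃ x ∈ W, H x = z ∧ f x = y)
    (S : Set E) (hS : ∀ x ∈ S, H x = 0 → f x = 0) {k c : ℕ}
    (hW : finrank F W = finrank F T' + finrank F T + (k + c)) :
    Nat.card F ^ (k * c) ≤ Nat.card {L : Submodule F E // L ≤ W ∧
      finrank F L = finrank F T + k ∧
      finrank F (Submodule.span F ((L : Set E) ∩ S)) + finrank F T ≤ finrank F L} := by
  let j := W.subtype ∘ₗ (LinearMap.ker (H.domRestrict W)).subtype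
  have hj : Function.Injective j :=
    W.injective_subtype.comp (LinearMap.ker (H.domRestrict W)).injective_subtype
  have hf : Function.Surjective (f ∘ₗ j) := fun y => by
    obtain ⟨x, hx, hz, hy⟩ := hHf 0 y
    exact ⟨⟨⟨x, hx⟩, hz⟩, hy⟩
  have hker := (H.domRestrict W).finrank_ker_of_surjective fun z => by
    obtain ⟨x, hx, hz, -⟩ := hHf z 0
    exact ⟨⟨x, hx⟩, hz⟩
  obtain ⟨L, hL, hdim⟩ := (f ∘ₗ j).exists_injective_family_of_surjective hf (k := k) (c := c)
    (by omega)
  have hcard : Nat.card ((Fin k → F) →ₗ[F] (Fin c → F)) = Nat.card F ^ (k * c) := by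
    rw [Module.natCard_eq_pow_finrank (K := F), finrank_linearMap]
    simp
  have hfin (M : Submodule F (LinearMap.ker (H.domRestrict W))) :
      finrank F (M.map j) = finrank F M :=
    (Submodule.equivMapOfInjective j hj M).finrank_eq.symm
  rw [← hcard]
  refine Nat.card_le_card_of_injective (fun φ => ⟨(L φ).map j, ?_, ?_, ?_⟩) fun φ φ' h =>
    hL (Submodule.map_injective_of_injective hj (congrArg Subtype.val h))
  · rintro _ ⟨u, -, rfl⟩
    exact u.1.2
  · rw [hfin, (hdim φ).1]
  · have hle : Submodule.span F (((L φ).map j : Set E) ∩ S) ≤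
        (L φ ⊓ LinearMap.ker (f ∘ₗ j)).map j := by
      rw [Submodule.span_le]
      rintro _ ⟨⟨u, hu, rfl⟩, hs⟩
      exact ⟨u, ⟨hu, hS _ hs u.2⟩, rfl⟩
    have := Submodule.finrank_mono hle
    rw [hfin, (hdim φ).2] at this
    rw [hfin, (hdim φ).1]
    omega

end LinearAlgebra

section Pluecker

variable {F ι κ : Type*} [Field F]

/-- The Plücker coordinate `v ∧ w ↦ v_a w_b - w_a v_b`, extended by zero to the other degrees of
the exterior algebra. -/
def plueckerCoord (a b : ι) : ExteriorAlgebra F (ι → F) →ₗ[F] F :=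
  ExteriorAlgebra.liftAlternating (Pi.single 2
    ((Matrix.detRowAlternating : (Fin 2 → F) [⋀^Fin 2]→ₗ[F] F).compLinearMap
      (LinearMap.funLeft F F ![a, b])))

theorem plueckerCoord_ι_mul_ι (a b : ι) (v w : ι → F) :
    plueckerCoord a b (ExteriorAlgebra.ι F v * ExteriorAlgebra.ι F w) =
      v a * w b - w a * v b := by
  have h : ExteriorAlgebra.ι F v * ExteriorAlgebra.ι F w = ExteriorAlgebra.ιMulti F 2 ![v, w] := by
    simp [ExteriorAlgebra.ιMulti_apply]
  rw [h, plueckerCoord, ExteriorAlgebra.liftAlternating_apply_ιMulti, Pi.single_eq_same]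
  refine (Matrix.det_fin_two
    (Matrix.of fun i => LinearMap.funLeft F F ![a, b] (![v, w] i))).trans ?_
  simp [LinearMap.funLeft_apply]
  ring

theorem finrank_grade2 [Fintype ι] :
    finrank F (grade2 F (ι → F)) = (Fintype.card ι).choose 2 := by
  have h : grade2 F (ι → F) = ⋀[F]^2 (ι → F) := by
    rw [← ExteriorAlgebra.ιMulti_span_fixedDegree, grade2]
    congr 1
    ext x
    constructor
    · rintro ⟨v, w, rfl⟩
      exact ⟨![v, w], by simp [ExteriorAlgebra.ιMulti_apply]⟩
    · rintro ⟨v, rfl⟩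
      exact ⟨v 0, v 1, by simp [ExteriorAlgebra.ιMulti_apply, Matrix.vecTail]⟩
  rw [h, exteriorPower.finrank_eq, finrank_fintype_fun_eq_card]

/-- The coordinates `x_{01}` of each block of four indices. -/
def blockCoord (e : κ × Fin 4 → ι) : ExteriorAlgebra F (ι → F) →ₗ[F] (κ → F) :=
  LinearMap.pi fun i => plueckerCoord (e (i, 0)) (e (i, 1))

/-- The forms `x_{01} - x_{23}`, `x_{13}`, `x_{12}` of each block of four indices. On their common
kernel the Plücker relation of a block reads `x_{01} ^ 2 = 0`. -/
def blockConstraint (e : κ × Fin 4 → ι) : ExteriorAlgebra F (ι → F) →ₗ[F] (κ × Fin 3 → F) :=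
  LinearMap.pi fun i =>
    ![plueckerCoord (e (i.1, 0)) (e (i.1, 1)) - plueckerCoord (e (i.1, 2)) (e (i.1, 3)),
      plueckerCoord (e (i.1, 1)) (e (i.1, 3)), plueckerCoord (e (i.1, 1)) (e (i.1, 2))] i.2

theorem blockCoord_eq_zero_of_mem_decompSet (e : κ × Fin 4 → ι) {x : ExteriorAlgebra F (ι → F)}
    (hx : x ∈ DecompSet F (ι → F)) (h : blockConstraint e x = 0) : blockCoord e x = 0 := by
  obtain ⟨v, w, rfl⟩ := hx
  funext i
  have h₀ := congrFun h (i, 0)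
  have h₁ := congrFun h (i, 1)
  have h₂ := congrFun h (i, 2)
  simp only [blockConstraint, LinearMap.pi_apply, Matrix.cons_val, LinearMap.sub_apply,
    plueckerCoord_ι_mul_ι, Pi.zero_apply] at h₀ h₁ h₂
  simp only [blockCoord, LinearMap.pi_apply, plueckerCoord_ι_mul_ι, Pi.zero_apply]
  set v₀ := v (e (i, 0)); set v₁ := v (e (i, 1)); set v₂ := v (e (i, 2)); set v₃ := v (e (i, 3))
  set w₀ := w (e (i, 0)); set w₁ := w (e (i, 1)); set w₂ := w (e (i, 2)); set w₃ := w (e (i, 3))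
  refine pow_eq_zero_iff two_ne_zero |>.1 ?_
  linear_combination (v₀ * w₁ - w₀ * v₁) * h₀ + (v₀ * w₂ - w₀ * v₂) * h₁ -
    (v₀ * w₃ - w₀ * v₃) * h₂

theorem exists_mem_grade2_blockConstraint_blockCoord [Fintype κ] [DecidableEq ι]
    {e : κ × Fin 4 → ι} (he : Function.Injective e) (z : κ × Fin 3 → F) (y : κ → F) :
    ∃ x ∈ grade2 F (ι → F), blockConstraint e x = z ∧ blockCoord e x = y := by
  classical
  let w (i : κ) (a b : Fin 4) : ExteriorAlgebra F (ι → F) :=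
    ExteriorAlgebra.ι F (Pi.single (e (i, a)) 1) * ExteriorAlgebra.ι F (Pi.single (e (i, b)) 1)
  have hw (i a b) : w i a b ∈ grade2 F (ι → F) :=
    Submodule.subset_span ⟨_, _, rfl⟩
  have hcoord (i i' a b a' b') : plueckerCoord (e (i, a)) (e (i, b)) (w i' a' b') =
      if i = i' then (if a = a' ∧ b = b' then 1 else 0) - (if a = b' ∧ b = a' then 1 else 0)
      else (0 : F) := by
    simp only [w, plueckerCoord_ι_mul_ι, Pi.single_apply, he.eq_iff, Prod.mk.injEq]
    split_ifs <;> simp_all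
  refine ⟨∑ i, (y i • w i 0 1 + (y i - z (i, 0)) • w i 2 3 + z (i, 1) • w i 1 3 +
    z (i, 2) • w i 1 2), ?_, ?_, ?_⟩
  · exact sum_mem fun i _ => add_mem (add_mem (add_mem (Submodule.smul_mem _ _ (hw _ _ _))
      (Submodule.smul_mem _ _ (hw _ _ _))) (Submodule.smul_mem _ _ (hw _ _ _)))
      (Submodule.smul_mem _ _ (hw _ _ _))
  · ext ⟨i, k⟩
    fin_cases k <;> simp [blockConstraint, hcoord]
  · ext i
    simp [blockCoord, hcoord]

end Pluecker

theorem finite_exteriorAlgebra (F : Type*) [Field F] [Finite F] (d : ℕ) :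
    Finite (ExteriorAlgebra F (Fin d → F)) :=
  have := (Module.Basis.ExteriorAlgebra (Pi.basisFun F (Fin d))).finiteDimensional_of_finite
  Module.finite_of_finite F

/-- For `N` disjoint blocks of four coordinates, the `r`-dimensional subspaces `L` with
`dim (L / L^∧) ≥ N` number at least `p^{(r-N)(ρ-3N)}`. -/
theorem pow_le_card_wedgePart {F : Type*} [Field F] [Finite F] {d k c N : ℕ}
    (hdN : 4 * N ≤ d) (hd : d.choose 2 = 4 * N + (k + c)) :
    Nat.card F ^ (k * c) ≤ Nat.card {L : Submodule F (ExteriorAlgebra F (Fin d → F)) //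
      L ≤ grade2 F (Fin d → F) ∧ finrank F L = N + k ∧
      finrank F (wedgePart F (Fin d → F) L) + N ≤ finrank F L} := by
  have := finite_exteriorAlgebra F d
  obtain ⟨e, he⟩ : ∃ e : Fin N × Fin 4 → Fin d, Function.Injective e :=
    ⟨fun i => Fin.castLE hdN (Fin.cast (mul_comm N 4) (finProdFinEquiv i)), fun _ _ h =>
      finProdFinEquiv.injective (Fin.cast_injective _ (Fin.castLE_injective hdN h))⟩
  have key := card_pow_le_card_submodule_span_inter (k := k) (c := c) (grade2 F (Fin d → F))
    (blockConstraint e) (blockCoord e) (exists_mem_grade2_blockConstraint_blockCoord he)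
    (DecompSet F (Fin d → F)) (fun _ => blockCoord_eq_zero_of_mem_decompSet e) (by
      rw [finrank_grade2]
      simp only [finrank_fintype_fun_eq_card, Fintype.card_prod, Fintype.card_fin]
      omega)
  rwa [finrank_fin_fun] at key

/-- with `ρ = binom(d,2) - r`, if `ρ ≥ 3`, `d > 4N`, `r > 3N` and
`ρ > 3N + 1`, then the number of `r`-dimensional subspaces `L` of `⋀²(F_p^d)` with
`dim(L/L^∧) ≥ N` is at least `p^{(r-3N)(ρ-3N-1)}`; in particular (taking `N = 1`)
the number of `r`-dimensional subspaces not spanned by decomposables is at least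
`p^{(r-3)(ρ-4)}`. -/
theorem stmt4 (p d r N : ℕ) (hp : p.Prime) (hp2 : 2 < p) (hd : 0 < d) (hr : 0 < r)
    (hN : 0 < N) (hρ : 3 ≤ d.choose 2 - r) (hdN : 4 * N < d) (hrN : 3 * N < r)
    (hρN : 3 * N + 1 < d.choose 2 - r) :
    p ^ ((r - 3 * N) * (d.choose 2 - r - 3 * N - 1)) ≤
        Nat.card {L : Submodule (ZMod p) (ExteriorAlgebra (ZMod p) (Fin d → ZMod p)) //
          L ≤ grade2 (ZMod p) (Fin d → ZMod p) ∧ finrank (ZMod p) L = r ∧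
          finrank (ZMod p) (wedgePart (ZMod p) (Fin d → ZMod p) L) + N ≤
            finrank (ZMod p) L} ∧
      (N = 1 →
        p ^ ((r - 3) * (d.choose 2 - r - 4)) ≤
          Nat.card {L : Submodule (ZMod p) (ExteriorAlgebra (ZMod p) (Fin d → ZMod p)) //
            L ≤ grade2 (ZMod p) (Fin d → ZMod p) ∧ finrank (ZMod p) L = r ∧
            ¬ SpannedByDecomposables (ZMod p) (Fin d → ZMod p) L}) := by
  have : Fact p.Prime := ⟨hp⟩
  have := finite_exteriorAlgebra (ZMod p) d
  have main : p ^ ((r - 3 * N) * (d.choose 2 - r - 3 * N - 1)) ≤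
      Nat.card {L : Submodule (ZMod p) (ExteriorAlgebra (ZMod p) (Fin d → ZMod p)) //
        L ≤ grade2 (ZMod p) (Fin d → ZMod p) ∧ finrank (ZMod p) L = r ∧
        finrank (ZMod p) (wedgePart (ZMod p) (Fin d → ZMod p) L) + N ≤ finrank (ZMod p) L} := by
    have key := pow_le_card_wedgePart (F := ZMod p) (d := d) (k := r - N)
      (c := d.choose 2 - r - 3 * N) hdN.le (by omega)
    rw [Nat.card_zmod, Nat.add_sub_cancel' (by omega : N ≤ r)] at key
    refine le_trans (Nat.pow_le_pow_right hp.pos ?_) key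
    exact Nat.mul_le_mul (by omega) (by omega)
  refine ⟨main, ?_⟩
  rintro rfl
  have hexp : d.choose 2 - r - 3 * 1 - 1 = d.choose 2 - r - 4 := by omega
  rw [hexp] at main
  refine main.trans (Nat.card_le_card_of_injective
    (Subtype.map id fun L ⟨h₁, h₂, h₃⟩ => ⟨h₁, h₂, fun h => ?_⟩)
    (Subtype.map_injective _ Function.injective_id))
  have : wedgePart (ZMod p) (Fin d → ZMod p) L = L := h.symm
  rw [this] at h₃
  omega

end
end

section
/- Fix a prime p > 2. Let #_all(n) be the number of isomorphism classes of groups of order p^n, and let #_{[G,G]≠K(G)}(n) be the number of isomorphism classes of groups G of order p^n in which some element of the derived subgroup [G,G] is not equal to a single commutator [x,y] with x, y ∈ G. Then lim_{n→∞} (log_p #_{[G,G]≠K(G)}(n)) / (log_p #_all(n)) = 1. -/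
open Filter

noncomputable section

/-- The multiplication of a group structure `s` on a type `α`. -/
def GroupMul {α : Type*} (s : Group α) : α → α → α := by
  letI := s; exact (· * ·)

/-- Two group structures on the same type are isomorphic if there is a
multiplication-preserving bijection between them. -/
def GroupsIso {α : Type*} (s t : Group α) : Prop :=
  ∃ e : α ≃ α, ∀ x y, e (GroupMul s x y) = GroupMul t (e x) (e y)

/-- The setoid of group structures on `α` up to isomorphism. -/
def groupSetoid (α : Type*) : Setoid (Group α) where
  r := GroupsIso
  iseqv := by
    constructor
    · exact fun s => ⟨Equiv.refl α, fun x y => rfl⟩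
    · rintro s t ⟨e, he⟩
      refine ⟨e.symm, fun x y => e.injective ?_⟩
      rw [Equiv.apply_symm_apply, he, Equiv.apply_symm_apply, Equiv.apply_symm_apply]
    · rintro s t u ⟨e, he⟩ ⟨f, hf⟩
      exact ⟨e.trans f, fun x y => by
        simp only [Equiv.trans_apply, he, hf]⟩

/-- Isomorphism classes of groups of order `m`, realised as group structures on
`Fin m` up to isomorphism. -/
def GroupClasses (m : ℕ) := Quotient (groupSetoid (Fin m))

/-- The property that some element of the derived subgroup `[G,G]` is not a single
commutator, for an explicit group structure `s` on `α`. -/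
def NotEveryCommutator {α : Type*} (s : Group α) : Prop := by
  letI := s
  exact ∃ g ∈ commutator α, ∀ x y : α, g ≠ x⁻¹ * y⁻¹ * x * y

/-- The type `α` regarded as a group through the group structure `s`. -/
def Carrier {α : Type*} (_ : Group α) : Type _ := α

instance {α : Type*} (s : Group α) : Group (Carrier s) := s

instance {α : Type*} [Finite α] (s : Group α) : Finite (Carrier s) := ‹Finite α›

theorem groupsIso_of_mulEquiv {α : Type*} {s t : Group α} (e : Carrier s ≃* Carrier t) :
    GroupsIso s t :=
  ⟨e.toEquiv, fun x y => e.map_mul x y⟩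

theorem GroupsIso.nonempty_mulEquiv {α : Type*} {s t : Group α} (h : GroupsIso s t) :
    Nonempty (Carrier s ≃* Carrier t) :=
  let ⟨e, he⟩ := h
  ⟨{ toEquiv := e, map_mul' := he }⟩

instance (m : ℕ) : Finite (GroupClasses m) := by
  have : Finite (Group (Fin m)) := by
    refine Finite.of_injective (fun s : Group (Fin m) => GroupMul s) fun s t h => ?_
    exact Group.ext (by ext x y; exact congrArg Fin.val (congrFun (congrFun h x) y))
  exact Quotient.finite _

/-- A group representing the isomorphism class `c`. -/
def GroupClasses.Rep {m : ℕ} (c : GroupClasses m) : Type := Carrier (Quotient.out c)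

instance {m : ℕ} (c : GroupClasses m) : Group c.Rep :=
  inferInstanceAs (Group (Carrier (Quotient.out c)))

instance {m : ℕ} (c : GroupClasses m) : Finite c.Rep :=
  inferInstanceAs (Finite (Carrier (Quotient.out c)))

theorem GroupClasses.card_rep {m : ℕ} (c : GroupClasses m) : Nat.card c.Rep = m :=
  Nat.card_fin m

theorem GroupClasses.eq_of_mulEquiv {m : ℕ} {c d : GroupClasses m} (e : c.Rep ≃* d.Rep) :
    c = d := by
  rw [← Quotient.out_eq c, ← Quotient.out_eq d]
  exact Quotient.sound (groupsIso_of_mulEquiv e)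

/-- The group structure on `Fin m` transported from a group of order `m`. -/
@[reducible]
def finGroup {m : ℕ} (G : Type) [Group G] [Finite G] (h : Nat.card G = m) : Group (Fin m) :=
  (Finite.equivFinOfCardEq h).symm.group

/-- The transported group structure is isomorphic to the original group. -/
def finGroupEquiv {m : ℕ} (G : Type) [Group G] [Finite G] (h : Nat.card G = m) :
    Carrier (finGroup G h) ≃* G :=
  letI := finGroup G h
  (Finite.equivFinOfCardEq h).symm.mulEquiv

/-- The isomorphism class of a group of order `m`. -/
def isoClass {m : ℕ} (G : Type) [Group G] [Finite G] (h : Nat.card G = m) : GroupClasses m :=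
  Quotient.mk _ (finGroup G h)

theorem nonempty_rep_isoClass {m : ℕ} (G : Type) [Group G] [Finite G] (h : Nat.card G = m) :
    Nonempty ((isoClass G h).Rep ≃* G) := by
  obtain ⟨e⟩ := GroupsIso.nonempty_mulEquiv
    (Quotient.exact (Quotient.out_eq (isoClass G h)) : GroupsIso _ (finGroup G h))
  exact ⟨MulEquiv.trans e (finGroupEquiv G h)⟩

/-- Some element of the derived subgroup of `G` is not a commutator. -/
def HasNonCommutator (G : Type*) [Group G] : Prop :=
  ∃ g ∈ commutator G, ∀ x y : G, g ≠ x⁻¹ * y⁻¹ * x * y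

theorem HasNonCommutator.of_surjective {G H : Type*} [Group G] [Group H] (f : G →* H)
    (hf : Function.Surjective f) (h : HasNonCommutator H) : HasNonCommutator G := by
  obtain ⟨g, hg, hne⟩ := h
  have hmap : (commutator G).map f = commutator H := by
    rw [commutator_def, Subgroup.map_commutator, commutator_def,
      Subgroup.map_top_of_surjective f hf]
  rw [← hmap] at hg
  obtain ⟨g', hg', rfl⟩ := hg
  exact ⟨g', hg', fun x y h => hne (f x) (f y) (by simp [h])⟩

/-- Isomorphism classes of groups of order `m` with an element of the derived subgroup that is
not a commutator. -/
abbrev NonCommutatorClasses (m : ℕ) :=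
  {c : GroupClasses m //
    ∃ s : Group (Fin m), Quotient.mk (groupSetoid (Fin m)) s = c ∧ NotEveryCommutator s}

theorem HasNonCommutator.isoClass {m : ℕ} {G : Type} [Group G] [Finite G] (h : Nat.card G = m)
    (hG : HasNonCommutator G) :
    ∃ s : Group (Fin m),
      Quotient.mk (groupSetoid (Fin m)) s = _root_.isoClass G h ∧ NotEveryCommutator s :=
  ⟨finGroup G h, rfl, of_surjective (G := Carrier (finGroup G h))
    (finGroupEquiv G h).toMonoidHom (finGroupEquiv G h).surjective hG⟩

/-- Finite groups with isomorphic products with `H`, compatibly on `H`, are isomorphic. -/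
theorem nonempty_mulEquiv_of_prod {G G' H X : Type*} [Group G] [Group G'] [Group H] [Group X]
    [Finite G'] (hcard : Nat.card G = Nat.card G') (e : G × H ≃* X) (e' : G' × H ≃* X)
    (he : ∀ h, e (1, h) = e' (1, h)) : Nonempty (G ≃* G') := by
  let f : G →* G' := (MonoidHom.fst G' H).comp
    ((e.trans e'.symm).toMonoidHom.comp (MonoidHom.inl G H))
  have hf : Function.Injective f := by
    refine (injective_iff_map_eq_one f).2 fun g hg => ?_
    have h1 : e'.symm (e (g, 1)) = (1, (e'.symm (e (g, 1))).2) := Prod.ext hg rfl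
    have h2 : e (g, 1) = e (1, (e'.symm (e (g, 1))).2) := by
      rw [he, ← h1, e'.apply_symm_apply]
    exact congrArg Prod.fst (e.injective h2)
  exact ⟨MulEquiv.ofBijective f ((Nat.bijective_iff_injective_and_card f).2 ⟨hf, hcard⟩)⟩

theorem card_classes_le_nonCommutatorClasses {m k : ℕ} {H : Type} [Group H] [Finite H]
    (hH : HasNonCommutator H) (hk : Nat.card H = k) :
    Nat.card (GroupClasses m) ≤ Nat.card (NonCommutatorClasses (m * k)) * (m * k) ^ k := by
  have hcard (c : GroupClasses m) : Nat.card (c.Rep × H) = m * k := by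
    rw [Nat.card_prod, c.card_rep, hk]
  let cls (c : GroupClasses m) : NonCommutatorClasses (m * k) :=
    ⟨isoClass (c.Rep × H) (hcard c),
      (hH.of_surjective (MonoidHom.snd c.Rep H) Prod.snd_surjective).isoClass (hcard c)⟩
  let e (c : GroupClasses m) : c.Rep × H ≃* (cls c).1.Rep :=
    (nonempty_rep_isoClass (c.Rep × H) (hcard c)).some.symm
  let f (c : GroupClasses m) : Σ d : NonCommutatorClasses (m * k), H → d.1.Rep :=
    ⟨cls c, fun h => e c (1, h)⟩
  have hf : Function.Injective f := by
    intro c d hcd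
    obtain ⟨h1, h2⟩ := Sigma.mk.inj_iff.1 hcd
    have key : ∀ (x : NonCommutatorClasses (m * k)) (e₁ : c.Rep × H ≃* x.1.Rep)
        (y : NonCommutatorClasses (m * k)) (e₂ : d.Rep × H ≃* y.1.Rep), x = y →
        HEq (fun h => e₁ (1, h)) (fun h => e₂ (1, h)) → c = d := by
      rintro x e₁ _ e₂ rfl h
      obtain ⟨E⟩ := nonempty_mulEquiv_of_prod (by rw [c.card_rep, d.card_rep]) e₁ e₂
        (congrFun (eq_of_heq h))
      exact GroupClasses.eq_of_mulEquiv E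
    exact key _ (e c) _ (e d) h1 h2
  have : Fintype (NonCommutatorClasses (m * k)) := Fintype.ofFinite _
  have hle := Nat.card_le_card_of_injective f hf
  simpa only [Nat.card_sigma, Nat.card_fun, GroupClasses.card_rep, hk, Finset.sum_const,
    Finset.card_univ, smul_eq_mul, ← Nat.card_eq_fintype_card] using hle

/-- The Heisenberg-type group of a biadditive map. -/
@[ext]
structure Heisenberg {U V W : Type*} [AddCommGroup U] [AddCommGroup V] [AddCommGroup W]
    (B : U →+ V →+ W) where
  fst : U
  snd : V
  thd : W

namespace Heisenberg

variable {U V W : Type*} [AddCommGroup U] [AddCommGroup V] [AddCommGroup W] (B : U →+ V →+ W)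

instance : Mul (Heisenberg B) :=
  ⟨fun x y => ⟨x.fst + y.fst, x.snd + y.snd, x.thd + y.thd + B x.fst y.snd⟩⟩

instance : One (Heisenberg B) := ⟨⟨0, 0, 0⟩⟩

instance : Inv (Heisenberg B) := ⟨fun x => ⟨-x.fst, -x.snd, -x.thd + B x.fst x.snd⟩⟩

@[simp] theorem fst_mul (x y : Heisenberg B) : (x * y).fst = x.fst + y.fst := rfl
@[simp] theorem snd_mul (x y : Heisenberg B) : (x * y).snd = x.snd + y.snd := rfl
@[simp] theorem thd_mul (x y : Heisenberg B) :
    (x * y).thd = x.thd + y.thd + B x.fst y.snd := rfl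
@[simp] theorem fst_one : (1 : Heisenberg B).fst = 0 := rfl
@[simp] theorem snd_one : (1 : Heisenberg B).snd = 0 := rfl
@[simp] theorem thd_one : (1 : Heisenberg B).thd = 0 := rfl
@[simp] theorem fst_inv (x : Heisenberg B) : x⁻¹.fst = -x.fst := rfl
@[simp] theorem snd_inv (x : Heisenberg B) : x⁻¹.snd = -x.snd := rfl
@[simp] theorem thd_inv (x : Heisenberg B) : x⁻¹.thd = -x.thd + B x.fst x.snd := rfl

instance : Group (Heisenberg B) :=
  Group.ofLeftAxioms
    (fun x y z => by
      ext1
      · simp [add_assoc]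
      · simp [add_assoc]
      · simp only [fst_mul, snd_mul, thd_mul, map_add, AddMonoidHom.add_apply]; abel)
    (fun x => by ext1 <;> simp)
    (fun x => by ext1 <;> simp)

/-- The underlying set of a Heisenberg-type group. -/
def equivProd : Heisenberg B ≃ U × V × W where
  toFun x := (x.fst, x.snd, x.thd)
  invFun x := ⟨x.1, x.2.1, x.2.2⟩

instance [Finite U] [Finite V] [Finite W] : Finite (Heisenberg B) :=
  Finite.of_equiv _ (equivProd B).symm

theorem card_eq : Nat.card (Heisenberg B) = Nat.card U * (Nat.card V * Nat.card W) := by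
  rw [Nat.card_congr (equivProd B), Nat.card_prod, Nat.card_prod]

theorem commutator_eq (x y : Heisenberg B) :
    x⁻¹ * y⁻¹ * x * y = ⟨0, 0, B x.fst y.snd - B y.fst x.snd⟩ := by
  ext1
  · simp
  · simp
  · simp only [fst_mul, thd_mul, fst_inv, snd_inv, thd_inv, map_add, map_neg,
      AddMonoidHom.add_apply, AddMonoidHom.neg_apply]
    abel

/-- The inclusion of the central subgroup `W`. -/
def incl : Multiplicative W →* Heisenberg B where
  toFun w := ⟨0, 0, w.toAdd⟩
  map_one' := rfl
  map_mul' x y := by ext1 <;> simp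

open scoped commutatorElement in
theorem incl_mem_commutator (u : U) (v : V) :
    incl B (Multiplicative.ofAdd (B u v)) ∈ commutator (Heisenberg B) := by
  have h : incl B (Multiplicative.ofAdd (B u v)) =
      ⁅(⟨u, 0, 0⟩ : Heisenberg B)⁻¹, (⟨0, v, 0⟩ : Heisenberg B)⁻¹⁆ := by
    rw [commutatorElement_def, inv_inv, inv_inv, commutator_eq]
    ext1 <;> simp [incl]
  rw [h]
  exact Subgroup.commutator_mem_commutator (Subgroup.mem_top _) (Subgroup.mem_top _)

end Heisenberg

/-- The outer product of vectors, as a biadditive map. -/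
def outerProduct (p k : ℕ) :
    (Fin k → ZMod p) →+ (Fin k → ZMod p) →+ (Fin k → Fin k → ZMod p) :=
  AddMonoidHom.mk' (fun u => AddMonoidHom.mk' (fun v i j => u i * v j)
    (fun v w => by ext i j; simp [mul_add])) (fun u v => by ext w i j; simp [add_mul])

theorem hasNonCommutator_heisenberg (p : ℕ) [Fact p.Prime] :
    HasNonCommutator (Heisenberg (outerProduct p 3)) := by
  let B := outerProduct p 3
  let e (i : Fin 3) : Fin 3 → ZMod p := Pi.single i 1
  refine ⟨Heisenberg.incl B (Multiplicative.ofAdd (B (e 0) (e 0))) *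
    Heisenberg.incl B (Multiplicative.ofAdd (B (e 1) (e 1))) *
    Heisenberg.incl B (Multiplicative.ofAdd (B (e 2) (e 2))),
    Subgroup.mul_mem _ (Subgroup.mul_mem _ (Heisenberg.incl_mem_commutator B _ _)
      (Heisenberg.incl_mem_commutator B _ _))
      (Heisenberg.incl_mem_commutator B _ _), fun x y h => ?_⟩
  rw [← map_mul, ← map_mul, Heisenberg.commutator_eq] at h
  have h3 := congrArg Heisenberg.thd h
  have hij (i j : Fin 3) : (if i = j then 1 else 0 : ZMod p) =
      x.fst i * y.snd j - y.fst i * x.snd j := by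
    refine Eq.trans ?_ (congrFun (congrFun h3 i) j)
    change _ = e 0 i * e 0 j + e 1 i * e 1 j + e 2 i * e 2 j
    fin_cases i <;> fin_cases j <;> simp [e]
  have hdet : (Matrix.of fun i j : Fin 3 => (if i = j then 1 else 0 : ZMod p)).det = 0 := by
    simp only [hij, Matrix.det_fin_three, Matrix.of_apply]
    ring
  simp [Matrix.det_fin_three] at hdet

/-- The biadditive map with structure constants `b`. -/
def bilinOfCoeff {p k l : ℕ} (b : Fin k → Fin k → Fin l → ZMod p) :
    (Fin k → ZMod p) →+ (Fin k → ZMod p) →+ (Fin l → ZMod p) :=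
  AddMonoidHom.mk' (fun u => AddMonoidHom.mk' (fun v m => ∑ i, ∑ j, u i * v j * b i j m)
    (fun v w => by ext m; simp [mul_add, add_mul, Finset.sum_add_distrib]))
    (fun u v => by ext w m; simp [add_mul, Finset.sum_add_distrib])

theorem bilinOfCoeff_single {p k l : ℕ} (b : Fin k → Fin k → Fin l → ZMod p) (i j : Fin k) :
    bilinOfCoeff b (Pi.single i 1) (Pi.single j 1) = b i j := by
  ext m
  simp [bilinOfCoeff, Pi.single_apply]

theorem hom_eq_of_single {p l : ℕ} [NeZero p] {X : Type*} [Group X]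
    {f g : Multiplicative (Fin l → ZMod p) →* X}
    (h : ∀ i, f (Multiplicative.ofAdd (Pi.single i 1)) = g (Multiplicative.ofAdd (Pi.single i 1))) :
    f = g := by
  refine MonoidHom.ext fun w => ?_
  have hw : w.toAdd = ∑ i, (w.toAdd i).val • (Pi.single i 1 : Fin l → ZMod p) := by
    ext j
    rw [Finset.sum_apply, Finset.sum_eq_single j (fun i _ hij => by simp [Ne.symm hij]) (by simp)]
    rw [Pi.smul_apply, Pi.single_eq_same, nsmul_one, ZMod.natCast_zmod_val]
  rw [← ofAdd_toAdd w, hw]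
  refine Finset.sum_induction _ (fun v => f (Multiplicative.ofAdd v) = g (Multiplicative.ofAdd v))
    (fun a b ha hb => ?_) ?_ fun i _ => ?_
  · rw [ofAdd_add, map_mul, map_mul, ha, hb]
  · rw [ofAdd_zero, map_one, map_one]
  · rw [ofAdd_nsmul, map_pow, map_pow, h]

/-- Structure constants are determined by the images of the standard generators under an
isomorphism to a fixed group. -/
theorem coeff_eq_of_mulEquiv {p k l : ℕ} [NeZero p] {X : Type*} [Group X]
    {b b' : Fin k → Fin k → Fin l → ZMod p}
    (e : Heisenberg (bilinOfCoeff b) ≃* X) (e' : Heisenberg (bilinOfCoeff b') ≃* X)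
    (h₁ : ∀ i, e ⟨Pi.single i 1, 0, 0⟩ = e' ⟨Pi.single i 1, 0, 0⟩)
    (h₂ : ∀ i, e ⟨0, Pi.single i 1, 0⟩ = e' ⟨0, Pi.single i 1, 0⟩)
    (h₃ : ∀ i, e ⟨0, 0, Pi.single i 1⟩ = e' ⟨0, 0, Pi.single i 1⟩) : b = b' := by
  have hhom : e.toMonoidHom.comp (Heisenberg.incl (bilinOfCoeff b)) =
      e'.toMonoidHom.comp (Heisenberg.incl (bilinOfCoeff b')) := hom_eq_of_single h₃
  have hcomm (c : Fin k → Fin k → Fin l → ZMod p) (i j : Fin k) :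
      (⟨0, 0, c i j⟩ : Heisenberg (bilinOfCoeff c)) =
        (⟨Pi.single i 1, 0, 0⟩ : Heisenberg (bilinOfCoeff c))⁻¹ * ⟨0, Pi.single j 1, 0⟩⁻¹ *
          ⟨Pi.single i 1, 0, 0⟩ * ⟨0, Pi.single j 1, 0⟩ := by
    rw [Heisenberg.commutator_eq, ← bilinOfCoeff_single c i j]
    simp
  funext i j
  have hthd : e ⟨0, 0, b i j⟩ = e ⟨0, 0, b' i j⟩ := by
    have : e ⟨0, 0, b' i j⟩ = e' ⟨0, 0, b' i j⟩ :=
      DFunLike.congr_fun hhom (Multiplicative.ofAdd (b' i j))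
    rw [this, hcomm b, hcomm b']
    simp only [map_mul, map_inv, h₁, h₂]
  exact congrArg Heisenberg.thd (e.injective hthd)

theorem pow_le_card_classes (p : ℕ) [NeZero p] (k l : ℕ) :
    p ^ (k * (k * l)) ≤
      Nat.card (GroupClasses (p ^ (k + (k + l)))) * p ^ ((k + (k + l)) * (k + (k + l))) := by
  have hcard (b : Fin k → Fin k → Fin l → ZMod p) :
      Nat.card (Heisenberg (bilinOfCoeff b)) = p ^ (k + (k + l)) := by
    simp [Heisenberg.card_eq, pow_add]
  let e (b : Fin k → Fin k → Fin l → ZMod p) :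
      Heisenberg (bilinOfCoeff b) ≃* (isoClass (Heisenberg (bilinOfCoeff b)) (hcard b)).Rep :=
    (nonempty_rep_isoClass _ (hcard b)).some.symm
  let f (b : Fin k → Fin k → Fin l → ZMod p) :
      Σ c : GroupClasses (p ^ (k + (k + l))), (Fin k ⊕ (Fin k ⊕ Fin l) → c.Rep) :=
    ⟨isoClass (Heisenberg (bilinOfCoeff b)) (hcard b),
      Sum.elim (fun i => e b ⟨Pi.single i 1, 0, 0⟩)
        (Sum.elim (fun i => e b ⟨0, Pi.single i 1, 0⟩) (fun i => e b ⟨0, 0, Pi.single i 1⟩))⟩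
  have hf : Function.Injective f := by
    intro b b' hbb
    obtain ⟨h1, h2⟩ := Sigma.mk.inj_iff.1 hbb
    generalize e b = E at h2
    generalize e b' = E' at h2
    generalize isoClass (Heisenberg (bilinOfCoeff b)) (hcard b) = x at *
    subst h1
    have h := congrFun (eq_of_heq h2)
    exact coeff_eq_of_mulEquiv E E' (fun i => h (.inl i)) (fun i => h (.inr (.inl i)))
      (fun i => h (.inr (.inr i)))
  have : Fintype (GroupClasses (p ^ (k + (k + l)))) := Fintype.ofFinite _
  have hle := Nat.card_le_card_of_injective f hf
  simp only [Nat.card_sigma, Nat.card_fun, GroupClasses.card_rep] at hle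
  simpa [← pow_mul, mul_comm, mul_left_comm, mul_assoc] using hle

theorem exists_central_of_card {p n : ℕ} [Fact p.Prime] {G : Type*} [Group G]
    (h : Nat.card G = p ^ (n + 1)) : ∃ z ∈ Subgroup.center G, orderOf z = p := by
  have hp : p.Prime := Fact.out
  have : Finite G := Nat.finite_of_card_ne_zero (by rw [h]; exact pow_ne_zero _ hp.ne_zero)
  have hG : IsPGroup p G := IsPGroup.of_card h
  have : Nontrivial G := by
    rw [← Finite.one_lt_card_iff_nontrivial, h]
    exact Nat.one_lt_pow n.succ_ne_zero hp.one_lt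
  have hZ := hG.center_nontrivial
  obtain ⟨k, hk⟩ := IsPGroup.iff_card.1 (hG.to_subgroup (Subgroup.center G))
  have hk0 : k ≠ 0 := by
    rintro rfl
    rw [← Finite.one_lt_card_iff_nontrivial, hk, pow_zero] at hZ
    exact lt_irrefl _ hZ
  obtain ⟨z, hz⟩ := exists_prime_orderOf_dvd_card' (G := Subgroup.center G) p
    (by rw [hk]; exact dvd_pow_self p hk0)
  exact ⟨z, z.2, by rw [Subgroup.orderOf_coe, hz]⟩

theorem zpowers_normal_of_mem_center {G : Type*} [Group G] {z : G}
    (hz : z ∈ Subgroup.center G) : (Subgroup.zpowers z).Normal :=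
  ⟨fun x hx g => by
    have hxc : x ∈ Subgroup.center G := (Subgroup.zpowers_le (H := Subgroup.center G)).2 hz hx
    rwa [Subgroup.mem_center_iff.1 hxc, mul_inv_cancel_right]⟩

theorem card_quotient_zpowers {p n : ℕ} [Fact p.Prime] {G : Type*} [Group G]
    (h : Nat.card G = p ^ (n + 1)) {z : G} (hz : orderOf z = p) :
    Nat.card (G ⧸ Subgroup.zpowers z) = p ^ n := by
  have := Subgroup.card_eq_card_quotient_mul_card_subgroup (Subgroup.zpowers z)
  rw [h, Nat.card_zpowers, hz, pow_succ] at this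
  exact (Nat.eq_of_mul_eq_mul_right (Fact.out : p.Prime).pos this).symm

theorem exists_generators {p : ℕ} [Fact p.Prime] (n : ℕ) :
    ∀ {G : Type} [Group G], Nat.card G = p ^ n →
      ∃ g : Fin n → G, Subgroup.closure (Set.range g) = ⊤ := by
  induction n with
  | zero =>
    intro G _ h
    have : Subsingleton G := (Nat.card_eq_one_iff_unique.1 (by simpa using h)).1
    exact ⟨Fin.elim0, Subsingleton.elim _ _⟩
  | succ n ih =>
    intro G _ h
    obtain ⟨z, hzc, hz⟩ := exists_central_of_card h
    have := zpowers_normal_of_mem_center hzc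
    obtain ⟨g, hg⟩ := ih (card_quotient_zpowers h hz)
    choose g' hg' using fun i => QuotientGroup.mk'_surjective (Subgroup.zpowers z) (g i)
    refine ⟨Fin.cons z g', ?_⟩
    set C := Subgroup.closure (Set.range (Fin.cons z g' : Fin (n + 1) → G))
    have hzC : Subgroup.zpowers z ≤ C := by
      rw [Subgroup.zpowers_le]
      exact Subgroup.subset_closure ⟨0, rfl⟩
    have hmap : C.map (QuotientGroup.mk' (Subgroup.zpowers z)) = ⊤ := by
      rw [eq_top_iff, ← hg, Subgroup.closure_le]
      rintro _ ⟨i, rfl⟩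
      exact ⟨g' i, Subgroup.subset_closure ⟨i.succ, rfl⟩, hg' i⟩
    have := congrArg (Subgroup.comap (QuotientGroup.mk' (Subgroup.zpowers z))) hmap
    rwa [Subgroup.comap_map_eq, QuotientGroup.ker_mk', Subgroup.comap_top,
      sup_eq_left.2 hzC] at this

/-- If `S / R` is a central subgroup of order `p` in `F / R`, generated by the image of `s`, then
relators for `F / S` yield relators for `F / R`. -/
theorem normalClosure_relators_eq {p : ℕ} [Fact p.Prime] {F ι κ : Type*} [Group F]
    {R S : Subgroup F} [R.Normal] (hRS : R ≤ S) (x : κ → F) (hx : Subgroup.closure (Set.range x) = ⊤)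
    (t : ι → F) (hS : S = Subgroup.normalClosure (Set.range t)) {s : F}
    (hsR : s ∉ R) (hsp : s ^ p ∈ R) (hcomm : ∀ y, s * y * s⁻¹ * y⁻¹ ∈ R)
    (a : ι → ℤ) (ha : ∀ i, t i * s ^ a i ∈ R) :
    R = Subgroup.normalClosure (Set.range (fun o : Option (ι ⊕ κ) =>
      o.elim (s ^ p) (Sum.elim (fun i => t i * s ^ a i) (fun j => s * x j * s⁻¹ * (x j)⁻¹)))) := by
  set N := Subgroup.normalClosure (Set.range (fun o : Option (ι ⊕ κ) =>
      o.elim (s ^ p) (Sum.elim (fun i => t i * s ^ a i) (fun j => s * x j * s⁻¹ * (x j)⁻¹))))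
  have hNp : s ^ p ∈ N := Subgroup.subset_normalClosure ⟨none, rfl⟩
  have hNt (i : ι) : t i * s ^ a i ∈ N := Subgroup.subset_normalClosure ⟨some (.inl i), rfl⟩
  have hNx (j : κ) : s * x j * s⁻¹ * (x j)⁻¹ ∈ N :=
    Subgroup.subset_normalClosure ⟨some (.inr j), rfl⟩
  have hNR : N ≤ R := by
    refine Subgroup.normalClosure_le_normal ?_
    rintro _ ⟨_ | i | j, rfl⟩
    exacts [hsp, ha i, hcomm _]
  refine le_antisymm (fun r hr => ?_) hNR
  let q := QuotientGroup.mk' N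
  have hker (y : F) : q y = 1 ↔ y ∈ N := QuotientGroup.eq_one_iff y
  have hcent : q s ∈ Subgroup.center (F ⧸ N) := by
    have htop : (⊤ : Subgroup F) ≤ (Subgroup.centralizer {q s}).comap q := by
      rw [← hx, Subgroup.closure_le]
      rintro _ ⟨j, rfl⟩
      have := (hker _).2 (hNx j)
      rw [map_mul, map_mul, map_mul, map_inv, map_inv, mul_inv_eq_one, mul_inv_eq_iff_eq_mul]
        at this
      exact Subgroup.mem_centralizer_singleton_iff.2 this.symm
    rw [Subgroup.mem_center_iff]
    intro g
    obtain ⟨y, rfl⟩ := QuotientGroup.mk'_surjective N g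
    exact Subgroup.mem_centralizer_singleton_iff.1 (htop (Subgroup.mem_top y))
  have := zpowers_normal_of_mem_center hcent
  have hSz : S ≤ (Subgroup.zpowers (q s)).comap q := by
    rw [hS]
    refine Subgroup.normalClosure_le_normal ?_
    rintro _ ⟨i, rfl⟩
    have := (hker _).2 (hNt i)
    rw [map_mul, map_zpow, mul_eq_one_iff_eq_inv, ← zpow_neg] at this
    exact Subgroup.mem_zpowers_iff.2 ⟨_, this.symm⟩
  obtain ⟨k, hk⟩ := Subgroup.mem_zpowers_iff.1 (hSz (hRS hr))
  have hkN : r⁻¹ * s ^ k ∈ N := by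
    rw [← hker, map_mul, map_inv, map_zpow, hk, inv_mul_cancel]
  have hkR : s ^ k ∈ R := by
    simpa using R.mul_mem hr (hNR hkN)
  have hdvd : (p : ℤ) ∣ k := by
    by_contra hnd
    have hcop : IsCoprime (p : ℤ) k :=
      (Nat.prime_iff_prime_int.1 Fact.out).coprime_iff_not_dvd.2 hnd
    obtain ⟨u, v, huv⟩ := hcop
    apply hsR
    rw [← zpow_one s, ← huv, zpow_add, mul_comm u, mul_comm v, zpow_mul, zpow_mul, zpow_natCast]
    exact R.mul_mem (R.zpow_mem hsp _) (R.zpow_mem hkR _)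
  obtain ⟨c, rfl⟩ := hdvd
  have hskN : s ^ ((p : ℤ) * c) ∈ N := by
    rw [zpow_mul, zpow_natCast]
    exact N.zpow_mem hNp c
  have := N.mul_mem hskN (N.inv_mem hkN)
  simpa using this

/-- A surjection from a finitely generated group onto a group of order `p ^ m` has a kernel that is
the normal closure of a number of elements linear in `m`. -/
theorem exists_relators {p : ℕ} [Fact p.Prime] {F κ : Type} [Group F] [Fintype κ] (x : κ → F)
    (hx : Subgroup.closure (Set.range x) = ⊤) (m : ℕ) :
    ∀ {G : Type} [Group G] (π : F →* G), Function.Surjective π → Nat.card G = p ^ m →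
      ∃ (ι : Type) (_ : Fintype ι) (t : ι → F),
        Fintype.card ι = Fintype.card κ + m * (Fintype.card κ + 1) ∧
          π.ker = Subgroup.normalClosure (Set.range t) := by
  induction m with
  | zero =>
    intro G _ π _ h
    have : Subsingleton G := (Nat.card_eq_one_iff_unique.1 (by simpa using h)).1
    refine ⟨κ, inferInstance, x, by simp, ?_⟩
    have h1 : π.ker = ⊤ := eq_top_iff.2 fun y _ => Subsingleton.elim _ _
    rw [h1, eq_comm, eq_top_iff, ← hx]
    exact Subgroup.closure_le_normalClosure
  | succ m ih =>
    intro G _ π hπ h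
    obtain ⟨z, hzc, hz⟩ := exists_central_of_card h
    have := zpowers_normal_of_mem_center hzc
    let q := QuotientGroup.mk' (Subgroup.zpowers z)
    obtain ⟨ι, _, t, hcard, ht⟩ := ih (q.comp π)
      ((QuotientGroup.mk'_surjective _).comp hπ) (card_quotient_zpowers h hz)
    obtain ⟨s, rfl⟩ := hπ z
    have hmem (y : F) : y ∈ (q.comp π).ker ↔ ∃ k : ℤ, π s ^ k = π y := by
      rw [MonoidHom.mem_ker, MonoidHom.comp_apply, QuotientGroup.mk'_apply,
        QuotientGroup.eq_one_iff, Subgroup.mem_zpowers_iff]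
    choose a ha using fun i => (hmem (t i)).1 (ht ▸ Subgroup.subset_normalClosure ⟨i, rfl⟩)
    refine ⟨Option (ι ⊕ κ), inferInstance, _, ?_, normalClosure_relators_eq (p := p) (s := s)
      (fun y hy => ?_) x hx t ht (fun hs => ?_) ?_ (fun y => ?_)
      (fun i => -a i) (fun i => ?_)⟩
    · rw [Fintype.card_option, Fintype.card_sum, hcard]
      ring
    · exact (hmem y).2 ⟨0, by rw [zpow_zero, MonoidHom.mem_ker.1 hy]⟩
    · rw [MonoidHom.mem_ker.1 hs, orderOf_one] at hz
      exact (Fact.out : p.Prime).one_lt.ne hz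
    · rw [MonoidHom.mem_ker, map_pow, ← hz, pow_orderOf_eq_one]
    · rw [MonoidHom.mem_ker, map_mul, map_mul, map_mul, map_inv, map_inv,
        ← Subgroup.mem_center_iff.1 hzc (π y)]
      group
    · rw [MonoidHom.mem_ker, map_mul, map_zpow, ← ha, zpow_neg, mul_inv_cancel]

theorem exists_presentation {p n : ℕ} [Fact p.Prime] {G : Type} [Group G]
    (h : Nat.card G = p ^ n) :
    ∃ (π : FreeGroup (Fin n) →* G) (t : Fin (n + n * (n + 1)) → FreeGroup (Fin n)),
      Function.Surjective π ∧ π.ker = Subgroup.normalClosure (Set.range t) := by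
  obtain ⟨g, hg⟩ := exists_generators n h
  have hπ : Function.Surjective (FreeGroup.lift g) := by
    rw [← MonoidHom.range_eq_top, FreeGroup.range_lift_eq_closure, hg]
  obtain ⟨ι, _, t, hcard, ht⟩ := exists_relators FreeGroup.of (FreeGroup.closure_range_of _) n
    (FreeGroup.lift g) hπ h
  rw [Fintype.card_fin] at hcard
  let e := (Fintype.equivFinOfCardEq hcard).symm
  exact ⟨FreeGroup.lift g, t ∘ e, hπ, by rw [ht, e.surjective.range_comp]⟩

theorem mem_center_comm {G : Type*} [Group G] {z : G} (hz : z ∈ Subgroup.center G) (g : G) :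
    g * z = z * g :=
  Subgroup.mem_center_iff.1 hz g

/-- The extension of a homomorphism by a central element. -/
def centralExtend {F G : Type*} [Group F] [Group G] (φ : F →* G) {z : G}
    (hz : z ∈ Subgroup.center G) : F × Multiplicative ℤ →* G :=
  φ.noncommCoprod (zpowersHom G z) fun f k => by
    rw [zpowersHom_apply]
    exact Commute.zpow_right (mem_center_comm hz _) _

theorem centralExtend_apply {F G : Type*} [Group F] [Group G] (φ : F →* G) {z : G}
    (hz : z ∈ Subgroup.center G) (x : F × Multiplicative ℤ) :
    centralExtend φ hz x = φ x.1 * z ^ x.2.toAdd := by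
  simp [centralExtend]

/-- A lift of the presentation `F / ⟨t⟩ = Q` to a central extension `G` of `Q` by the group generated
by `z` of order `p`, with the relators `t i` lifting to the powers `z ^ a i`. -/
structure IsCentralLift {F Q G ι : Type*} [Group F] [Group Q] [Group G] (p : ℕ) (π : F →* Q)
    (t : ι → F) (a : ι → ℕ) (φ : F →* G) (q : G →* Q) (z : G) : Prop where
  mem_center : z ∈ Subgroup.center G
  orderOf_eq : orderOf z = p
  ker_eq : q.ker = Subgroup.zpowers z
  comp_eq : q.comp φ = π
  relator : ∀ i, φ (t i) = z ^ a i

namespace IsCentralLift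

variable {F Q G G' ι : Type*} [Group F] [Group Q] [Group G] [Group G'] {p : ℕ} {π : F →* Q}
  {t : ι → F} {a : ι → ℕ} {φ : F →* G} {q : G →* Q} {z : G} {φ' : F →* G'} {q' : G' →* Q} {z' : G'}

theorem centralExtend_surjective (h : IsCentralLift p π t a φ q z)
    (hπ : Function.Surjective π) : Function.Surjective (centralExtend φ h.mem_center) := by
  intro g
  obtain ⟨f, hf⟩ := hπ (q g)
  have hker : (φ f)⁻¹ * g ∈ q.ker := by
    rw [MonoidHom.mem_ker, map_mul, map_inv, ← MonoidHom.comp_apply, h.comp_eq, hf,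
      inv_mul_cancel]
  rw [h.ker_eq] at hker
  obtain ⟨k, hk⟩ := Subgroup.mem_zpowers_iff.1 hker
  exact ⟨(f, Multiplicative.ofAdd k), by rw [centralExtend_apply]; simp [hk]⟩

theorem ker_centralExtend_le (h : IsCentralLift p π t a φ q z)
    (h' : IsCentralLift p π t a φ' q' z')
    (ht : π.ker = Subgroup.normalClosure (Set.range t)) :
    (centralExtend φ h.mem_center).ker ≤ (centralExtend φ' h'.mem_center).ker := by
  rintro ⟨f, k⟩ hfk
  rw [MonoidHom.mem_ker, centralExtend_apply] at hfk ⊢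
  dsimp only at hfk ⊢
  generalize k.toAdd = k at *
  have hf : f ∈ π.ker := by
    have hz : q z = 1 := by
      rw [← MonoidHom.mem_ker, h.ker_eq]
      exact Subgroup.mem_zpowers z
    have := congrArg q hfk
    rwa [map_mul, map_zpow, hz, one_zpow, mul_one, map_one, ← MonoidHom.comp_apply,
      h.comp_eq] at this
  have key : ∃ j : ℤ, φ f = z ^ j ∧ φ' f = z' ^ j := by
    rw [ht] at hf
    let D : Subgroup F :=
      { carrier := {f | ∃ j : ℤ, φ f = z ^ j ∧ φ' f = z' ^ j}
        one_mem' := ⟨0, by simp⟩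
        mul_mem' := by
          rintro f g ⟨j, hj, hj'⟩ ⟨k, hk, hk'⟩
          exact ⟨j + k, by rw [map_mul, hj, hk, zpow_add], by rw [map_mul, hj', hk', zpow_add]⟩
        inv_mem' := by
          rintro f ⟨j, hj, hj'⟩
          exact ⟨-j, by rw [map_inv, hj, zpow_neg], by rw [map_inv, hj', zpow_neg]⟩ }
    have hD : D.Normal := by
      refine ⟨?_⟩
      rintro f ⟨j, hj, hj'⟩ g
      refine ⟨j, ?_, ?_⟩
      · rw [map_mul, map_mul, map_inv, hj,
          mem_center_comm (Subgroup.zpow_mem _ h.mem_center j), mul_inv_cancel_right]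
      · rw [map_mul, map_mul, map_inv, hj',
          mem_center_comm (Subgroup.zpow_mem _ h'.mem_center j), mul_inv_cancel_right]
    have hle : Subgroup.normalClosure (Set.range t) ≤ D := by
      refine Subgroup.normalClosure_le_normal ?_
      rintro _ ⟨i, rfl⟩
      exact ⟨a i, by rw [h.relator, zpow_natCast], by rw [h'.relator, zpow_natCast]⟩
    exact hle hf
  obtain ⟨j, hj, hj'⟩ := key
  rw [hj, ← zpow_add, ← orderOf_dvd_iff_zpow_eq_one, h.orderOf_eq] at hfk
  rwa [hj', ← zpow_add, ← orderOf_dvd_iff_zpow_eq_one, h'.orderOf_eq]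

theorem nonempty_mulEquiv (h : IsCentralLift p π t a φ q z)
    (h' : IsCentralLift p π t a φ' q' z') (hπ : Function.Surjective π)
    (ht : π.ker = Subgroup.normalClosure (Set.range t)) : Nonempty (G ≃* G') := by
  have hker := le_antisymm (h.ker_centralExtend_le h' ht) (h'.ker_centralExtend_le h ht)
  exact ⟨(QuotientGroup.quotientKerEquivOfSurjective _ (h.centralExtend_surjective hπ)).symm.trans
    ((QuotientGroup.quotientMulEquivOfEq hker).trans
      (QuotientGroup.quotientKerEquivOfSurjective _ (h'.centralExtend_surjective hπ)))⟩

end IsCentralLift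

theorem exists_isCentralLift {F G Q ι : Type*} [Group F] [Group G] [Group Q] {p : ℕ} [NeZero p]
    {π : F →* Q} {t : ι → F} (ht : ∀ i, π (t i) = 1) {φ : F →* G} {q : G →* Q} {z : G}
    (hzc : z ∈ Subgroup.center G) (hz : orderOf z = p) (hq : q.ker = Subgroup.zpowers z)
    (hφ : q.comp φ = π) : ∃ a : ι → Fin p, IsCentralLift p π t (fun i => a i) φ q z := by
  have hmem (i : ι) : ∃ a : Fin p, φ (t i) = z ^ (a : ℕ) := by
    have : φ (t i) ∈ Subgroup.zpowers z := by
      rw [← hq, MonoidHom.mem_ker, ← MonoidHom.comp_apply, hφ, ht]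
    classical
    have hfin : IsOfFinOrder z := orderOf_pos_iff.1 (hz ▸ Nat.pos_of_neZero p)
    obtain ⟨k, hk, hk'⟩ := (hfin.mem_zpowers_iff_mem_range_orderOf).1 this |> Finset.mem_image.1
    exact ⟨⟨k, by rw [← hz]; exact Finset.mem_range.1 hk⟩, hk'.symm⟩
  choose a ha using hmem
  exact ⟨a, hzc, hz, hq, hφ, ha⟩

theorem card_classes_succ_le (p : ℕ) [Fact p.Prime] (n : ℕ) :
    Nat.card (GroupClasses (p ^ (n + 1))) ≤
      Nat.card (GroupClasses (p ^ n)) * p ^ (n + n * (n + 1)) := by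
  choose π t hπ ht using fun c : GroupClasses (p ^ n) => exists_presentation c.card_rep
  have hdata (c : GroupClasses (p ^ (n + 1))) :
      ∃ x : GroupClasses (p ^ n) × (Fin (n + n * (n + 1)) → Fin p),
        ∃ (φ : FreeGroup (Fin n) →* c.Rep) (q : c.Rep →* x.1.Rep) (z : c.Rep),
          IsCentralLift p (π x.1) (t x.1) (fun i => x.2 i) φ q z := by
    obtain ⟨z, hzc, hz⟩ := exists_central_of_card c.card_rep
    have := zpowers_normal_of_mem_center hzc
    have hcard := card_quotient_zpowers c.card_rep hz
    let d := isoClass (c.Rep ⧸ Subgroup.zpowers z) hcard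
    obtain ⟨e⟩ := nonempty_rep_isoClass (c.Rep ⧸ Subgroup.zpowers z) hcard
    let q : c.Rep →* d.Rep := e.symm.toMonoidHom.comp (QuotientGroup.mk' (Subgroup.zpowers z))
    have hq : q.ker = Subgroup.zpowers z := by
      exact (MonoidHom.ker_mulEquiv_comp _ e.symm).trans (QuotientGroup.ker_mk' _)
    have hqs : Function.Surjective q := e.symm.surjective.comp (QuotientGroup.mk'_surjective _)
    choose g hg using fun i => hqs (π d (FreeGroup.of i))
    have hrel (i) : π d (t d i) = 1 := by
      rw [← MonoidHom.mem_ker, ht]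
      exact Subgroup.subset_normalClosure ⟨i, rfl⟩
    obtain ⟨a, ha⟩ := exists_isCentralLift (φ := FreeGroup.lift g) hrel hzc hz hq
      (FreeGroup.ext_hom _ _ fun i => by simp [hg])
    exact ⟨(d, a), _, q, z, ha⟩
  choose f φ q z hf using hdata
  have hinj : Function.Injective f := by
    intro c d hcd
    have hc := hf c
    have hd := hf d
    generalize q c = qc at hc
    generalize q d = qd at hd
    generalize f c = x at *
    subst hcd
    obtain ⟨e⟩ := hc.nonempty_mulEquiv hd (hπ _) (ht _)
    exact GroupClasses.eq_of_mulEquiv e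
  simpa [Nat.card_fun] using Nat.card_le_card_of_injective f hinj

/-- The base-`p` logarithm of the number of groups of order `p ^ n`. -/
def logClasses (p n : ℕ) : ℝ := Real.logb p (Nat.card (GroupClasses (p ^ n)))

/-- The base-`p` logarithm of the number of groups of order `p ^ n` with an element of the derived
subgroup that is not a commutator. -/
def logNonCommutatorClasses (p n : ℕ) : ℝ :=
  Real.logb p (Nat.card (NonCommutatorClasses (p ^ n)))

theorem logb_le_add_of_le_mul_pow {p x y k : ℕ} (hp : 1 < p) (hx : 0 < x) (h : x ≤ y * p ^ k) :
    Real.logb p x ≤ Real.logb p y + k := by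
  have hp' : (1 : ℝ) < p := by exact_mod_cast hp
  have hy : y ≠ 0 := by
    rintro rfl
    omega
  calc Real.logb p x ≤ Real.logb p ((y : ℝ) * (p : ℝ) ^ k) :=
        Real.logb_le_logb_of_le hp' (by exact_mod_cast hx) (by exact_mod_cast h)
    _ = Real.logb p y + k := by
        rw [Real.logb_mul (by exact_mod_cast hy) (by positivity), Real.logb_pow,
          Real.logb_self_eq_one hp', mul_one]

theorem card_classes_pos (p : ℕ) [NeZero p] (n : ℕ) : 0 < Nat.card (GroupClasses (p ^ n)) := by
  by_contra h
  have := pow_le_card_classes p 0 n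
  rw [zero_add, zero_add, Nat.eq_zero_of_not_pos h, zero_mul, zero_mul, pow_zero] at this
  omega

theorem logClasses_add_le (p : ℕ) [Fact p.Prime] (n j : ℕ) :
    logClasses p (n + j) ≤ logClasses p n + j * ((n : ℝ) + j) ^ 2 := by
  induction j with
  | zero => simp
  | succ j ih =>
    have h := logb_le_add_of_le_mul_pow (Fact.out : p.Prime).one_lt (card_classes_pos p _)
      (card_classes_succ_le p (n + j))
    change logClasses p (n + j + 1) ≤ logClasses p (n + j) + _ at h
    rw [← add_assoc]
    push_cast at h ⊢
    have hn : (0 : ℝ) ≤ n := n.cast_nonneg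
    have hj : (0 : ℝ) ≤ j := j.cast_nonneg
    nlinarith [mul_nonneg hj hn, mul_nonneg hj hj]

theorem logNonCommutatorClasses_le (p : ℕ) [Fact p.Prime] (n : ℕ) :
    logNonCommutatorClasses p n ≤ logClasses p n := by
  have hp : (1 : ℝ) < p := by exact_mod_cast (Fact.out : p.Prime).one_lt
  have hle : Nat.card (NonCommutatorClasses (p ^ n)) ≤ Nat.card (GroupClasses (p ^ n)) :=
    Nat.card_le_card_of_injective _ Subtype.val_injective
  rcases Nat.eq_zero_or_pos (Nat.card (NonCommutatorClasses (p ^ n))) with h | h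
  · rw [logNonCommutatorClasses, h, Nat.cast_zero, Real.logb_zero]
    exact Real.logb_nonneg hp (by exact_mod_cast card_classes_pos p n)
  · exact Real.logb_le_logb_of_le hp (by exact_mod_cast h) (by exact_mod_cast hle)

theorem logClasses_le_logNonCommutatorClasses (p : ℕ) [Fact p.Prime] (n : ℕ) :
    logClasses p n ≤ logNonCommutatorClasses p (n + 15) + (n + 15) * (p : ℝ) ^ 15 := by
  have hcard : Nat.card (Heisenberg (outerProduct p 3)) = p ^ 15 := by
    simp only [Heisenberg.card_eq, Nat.card_fun, Nat.card_zmod, Nat.card_fin]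
    ring
  have h := card_classes_le_nonCommutatorClasses (m := p ^ n) (hasNonCommutator_heisenberg p) hcard
  rw [← pow_add, ← pow_mul] at h
  have := logb_le_add_of_le_mul_pow (Fact.out : p.Prime).one_lt (card_classes_pos p _) h
  push_cast at this
  exact this

theorem cube_le_logClasses (p : ℕ) [Fact p.Prime] {n : ℕ} (hn : 432 ≤ n) :
    (n : ℝ) ^ 3 / 432 ≤ logClasses p n := by
  have hp := (Fact.out : p.Prime)
  obtain ⟨k, l, hkl, hn', hk⟩ : ∃ k l : ℕ, k ≤ l ∧ k + (k + l) = n ∧ n ≤ 6 * k :=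
    ⟨n / 3, n - 2 * (n / 3), by omega, by omega, by omega⟩
  have h := pow_le_card_classes p k l
  rw [hn'] at h
  have h := logb_le_add_of_le_mul_pow hp.one_lt (pow_pos hp.pos _) h
  have hp' : (1 : ℝ) < p := by exact_mod_cast hp.one_lt
  push_cast at h
  rw [Real.logb_pow, Real.logb_self_eq_one hp', mul_one] at h
  change _ ≤ logClasses p n + _ at h
  push_cast at h
  have h1 : ((n : ℝ) / 6) ^ 3 ≤ (k : ℝ) * (k * l) := by
    have hk' : (n : ℝ) / 6 ≤ k := by
      rw [div_le_iff₀ (by norm_num), mul_comm]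
      exact_mod_cast hk
    have hkl' : (k : ℝ) ≤ l := by exact_mod_cast hkl
    calc ((n : ℝ) / 6) ^ 3 ≤ (k : ℝ) ^ 3 := by gcongr
      _ = (k : ℝ) * (k * k) := by ring
      _ ≤ (k : ℝ) * (k * l) := by gcongr
  have h2 : (432 : ℝ) * (n * n) ≤ n * (n * n) := by
    gcongr
    exact_mod_cast hn
  linarith [h1, h2, h, show ((n : ℝ) / 6) ^ 3 = n * (n * n) / 216 by ring,
    show (n : ℝ) ^ 3 / 432 = n * (n * n) / 432 by ring]

/-- fix a prime `p > 2`.  With `#all(n)` the number of isomorphism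
classes of groups of order `p^n` and `#[G,G]≠K(G)(n)` the number of isomorphism
classes of groups of order `p^n` in which some element of the derived subgroup is
not a single commutator, `lim_{n→∞} log_p #[G,G]≠K(G)(n) / log_p #all(n) = 1`. -/
theorem stmt5 (p : ℕ) (hp : p.Prime) (hp2 : 2 < p) :
    Filter.Tendsto (fun n : ℕ =>
      Real.logb p (Nat.card {c : GroupClasses (p ^ n) //
        ∃ s : Group (Fin (p ^ n)),
          Quotient.mk (groupSetoid (Fin (p ^ n))) s = c ∧ NotEveryCommutator s}) /
      Real.logb p (Nat.card (GroupClasses (p ^ n))))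
      Filter.atTop (nhds 1) := by
  have : Fact p.Prime := ⟨hp⟩
  change Tendsto (fun n => logNonCommutatorClasses p n / logClasses p n) atTop (nhds 1)
  set C : ℝ := 432 * (15 + (p : ℝ) ^ 15) with hC
  have hlim : Tendsto (fun n : ℕ => 1 - C / (n : ℝ)) atTop (nhds 1) := by
    simpa using (tendsto_const_div_atTop_nhds_zero_nat C).const_sub 1
  refine tendsto_of_tendsto_of_tendsto_of_le_of_le' hlim tendsto_const_nhds ?_ ?_
  · filter_upwards [eventually_ge_atTop 432] with n hn
    have hn0 : (0 : ℝ) < n := by exact_mod_cast (by omega : 0 < n)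
    have hcube := cube_le_logClasses p hn
    have hpos : 0 < logClasses p n := lt_of_lt_of_le (by positivity) hcube
    obtain ⟨m, rfl⟩ : ∃ m, n = m + 15 := ⟨n - 15, by omega⟩
    have h1 := logClasses_add_le p m 15
    have h2 := logClasses_le_logNonCommutatorClasses p m
    have hcast : ((m + 15 : ℕ) : ℝ) = m + 15 := by push_cast; rfl
    rw [Nat.cast_ofNat, ← hcast] at h1
    rw [← hcast] at h2
    have hx1 : (1 : ℝ) ≤ (m + 15 : ℕ) := by exact_mod_cast (by omega : 1 ≤ m + 15)
    generalize ((m + 15 : ℕ) : ℝ) = x at *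
    have hxx : x * (p : ℝ) ^ 15 ≤ x ^ 2 * (p : ℝ) ^ 15 := by
      refine mul_le_mul_of_nonneg_right ?_ (by positivity)
      rw [sq]
      exact le_mul_of_one_le_right hn0.le hx1
    have herr : x ^ 2 * (15 + (p : ℝ) ^ 15) ≤ C / x * logClasses p (m + 15) := by
      calc x ^ 2 * (15 + (p : ℝ) ^ 15) = C / x * (x ^ 3 / 432) := by
            rw [hC]
            field_simp
        _ ≤ _ := by gcongr
    rw [le_div_iff₀ hpos]
    linarith
  · filter_upwards [eventually_ge_atTop 432] with n hn
    have hn0 : (0 : ℝ) < n := by exact_mod_cast (by omega : 0 < n)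
    have hpos : 0 < logClasses p n := lt_of_lt_of_le (by positivity) (cube_le_logClasses p hn)
    exact (div_le_one hpos).2 (logNonCommutatorClasses_le p n)

end
end

section
/- The limit over primes p → ∞ of the ratio (number of 2-dimensional F_p-subspaces of ⋀²(F_p^4) that are spanned by decomposables) / (number of all 2-dimensional F_p-subspaces of ⋀²(F_p^4)) equals 1/2. -/
open Module Filter

noncomputable section

variable (K : Type*) [CommRing K] (V : Type*) [AddCommGroup V] [Module K V]

section PluckerCoordinates

variable {F : Type*} [Field F]

/-- The Plücker quadratic form on `F⁶ ≃ ⋀² F⁴`, in the coordinates `01, 02, 03, 12, 13, 23`. -/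
def pluckerForm (x : Fin 6 → F) : F := x 0 * x 5 - x 1 * x 4 + x 2 * x 3

/-- The polar form of `pluckerForm`. -/
def pluckerPolar (x y : Fin 6 → F) : F :=
  x 0 * y 5 + x 5 * y 0 - x 1 * y 4 - x 4 * y 1 + x 2 * y 3 + x 3 * y 2

/-- The Plücker coordinates of `v ∧ w`. -/
def pluckerCoords (v w : Fin 4 → F) : Fin 6 → F :=
  ![v 0 * w 1 - v 1 * w 0, v 0 * w 2 - v 2 * w 0, v 0 * w 3 - v 3 * w 0,
    v 1 * w 2 - v 2 * w 1, v 1 * w 3 - v 3 * w 1, v 2 * w 3 - v 3 * w 2]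

theorem pluckerForm_pluckerCoords (v w : Fin 4 → F) : pluckerForm (pluckerCoords v w) = 0 := by
  simp [pluckerForm, pluckerCoords]
  ring

theorem exists_pluckerCoords_eq {x : Fin 6 → F} (hx : pluckerForm x = 0) :
    ∃ v w : Fin 4 → F, pluckerCoords v w = x := by
  unfold pluckerForm at hx
  by_cases h0 : x 0 ≠ 0
  · refine ⟨![0, x 0, x 1, x 2], (x 0)⁻¹ • ![-x 0, 0, x 3, x 4], ?_⟩
    ext i
    fin_cases i <;> simp [pluckerCoords] <;> field_simp
    linear_combination -hx
  by_cases h1 : x 1 ≠ 0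
  · refine ⟨![0, x 0, x 1, x 2], (x 1)⁻¹ • ![-x 1, -x 3, 0, x 5], ?_⟩
    ext i
    fin_cases i <;> simp [pluckerCoords] <;> field_simp
    linear_combination hx
  by_cases h2 : x 2 ≠ 0
  · refine ⟨![0, x 0, x 1, x 2], (x 2)⁻¹ • ![-x 2, -x 4, -x 5, 0], ?_⟩
    ext i
    fin_cases i <;> simp [pluckerCoords] <;> field_simp
    linear_combination -hx
  push Not at h0 h1 h2
  by_cases h3 : x 3 ≠ 0
  · refine ⟨![-x 0, 0, x 3, x 4], (x 3)⁻¹ • ![-x 1, -x 3, 0, x 5], ?_⟩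
    ext i
    fin_cases i <;> simp [pluckerCoords, h0, h1, h2] <;> field_simp
  by_cases h4 : x 4 ≠ 0
  · refine ⟨![-x 0, 0, x 3, x 4], (x 4)⁻¹ • ![-x 2, -x 4, -x 5, 0], ?_⟩
    ext i
    fin_cases i <;> simp [pluckerCoords, h0, h1, h2] <;> field_simp
  push Not at h3 h4
  refine ⟨![0, 0, x 5, 0], ![0, 0, 0, 1], ?_⟩
  ext i
  fin_cases i <;> simp [pluckerCoords, h0, h1, h2, h3, h4]

theorem pluckerForm_smul_add_smul (a b : F) (x y : Fin 6 → F) :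
    pluckerForm (a • x + b • y) =
      a ^ 2 * pluckerForm x + b ^ 2 * pluckerForm y + a * b * pluckerPolar x y := by
  simp [pluckerForm, pluckerPolar]
  ring

/-- The parametrization of `⋀² F⁴` inside the exterior algebra by Plücker coordinates. -/
def ofPlucker (F : Type*) [Field F] : (Fin 6 → F) →ₗ[F] ExteriorAlgebra F (Fin 4 → F) :=
  let e (i : Fin 4) : ExteriorAlgebra F (Fin 4 → F) := ExteriorAlgebra.ι F (Pi.single i 1)
  Fintype.linearCombination F
    ![e 0 * e 1, e 0 * e 2, e 0 * e 3, e 1 * e 2, e 1 * e 3, e 2 * e 3]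

theorem ofPlucker_pluckerCoords (v w : Fin 4 → F) :
    ofPlucker F (pluckerCoords v w) = ExteriorAlgebra.ι F v * ExteriorAlgebra.ι F w := by
  have expand (v : Fin 4 → F) : ExteriorAlgebra.ι F v =
      ∑ i, v i • ExteriorAlgebra.ι F (Pi.single i (1 : F)) := by
    conv_lhs => rw [pi_eq_sum_univ' v]
    simp only [map_sum, map_smul]
  have sq (i : Fin 4) := ExteriorAlgebra.ι_sq_zero (R := F) (Pi.single i (1 : F) : Fin 4 → F)
  have swap (i j : Fin 4) := eq_neg_of_add_eq_zero_left <|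
    ExteriorAlgebra.ι_add_mul_swap (R := F) (Pi.single i (1 : F) : Fin 4 → F) (Pi.single j 1)
  rw [expand v, expand w]
  simp only [ofPlucker, Fintype.linearCombination_apply, Fin.sum_univ_succ, Fin.sum_univ_zero,
    pluckerCoords, add_mul, mul_add, smul_mul_smul_comm]
  simp [sq]
  rw [swap 1 0, swap 2 0, swap 3 0, swap 2 1, swap 3 1, swap 3 2]
  module

theorem decompSet_subset_range_ofPlucker :
    DecompSet F (Fin 4 → F) ⊆ LinearMap.range (ofPlucker F) := by
  rintro _ ⟨v, w, rfl⟩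
  exact ⟨_, ofPlucker_pluckerCoords v w⟩

theorem grade2_eq_exteriorPower (F V : Type*) [Field F] [AddCommGroup V] [Module F V] :
    grade2 F V = ⋀[F]^2 V := by
  rw [ExteriorAlgebra.exteriorPower, pow_two]
  apply le_antisymm
  · refine Submodule.span_le.2 ?_
    rintro _ ⟨v, w, rfl⟩
    exact Submodule.mul_mem_mul ⟨v, rfl⟩ ⟨w, rfl⟩
  · refine Submodule.mul_le.2 ?_
    rintro _ ⟨v, rfl⟩ _ ⟨w, rfl⟩
    exact Submodule.subset_span ⟨v, w, rfl⟩

theorem range_ofPlucker : LinearMap.range (ofPlucker F) = grade2 F (Fin 4 → F) := by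
  apply le_antisymm
  · rintro _ ⟨x, rfl⟩
    rw [ofPlucker, Fintype.linearCombination_apply]
    refine Submodule.sum_mem _ fun i _ => Submodule.smul_mem _ _ (Submodule.subset_span ?_)
    fin_cases i <;> exact ⟨_, _, rfl⟩
  · exact Submodule.span_le.2 decompSet_subset_range_ofPlucker

theorem ofPlucker_injective : Function.Injective (ofPlucker F) := by
  have h := (ofPlucker F).finrank_range_add_finrank_ker
  rw [range_ofPlucker, grade2_eq_exteriorPower, exteriorPower.finrank_eq] at h
  simp [Nat.choose] at h
  exact LinearMap.ker_eq_bot.1 h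

theorem ofPlucker_mem_decompSet_iff (x : Fin 6 → F) :
    ofPlucker F x ∈ DecompSet F (Fin 4 → F) ↔ pluckerForm x = 0 := by
  constructor
  · rintro ⟨v, w, hvw⟩
    rw [← ofPlucker_pluckerCoords] at hvw
    rw [ofPlucker_injective hvw, pluckerForm_pluckerCoords]
  · intro hx
    obtain ⟨v, w, rfl⟩ := exists_pluckerCoords_eq hx
    exact ⟨v, w, ofPlucker_pluckerCoords v w⟩

theorem spannedByDecomposables_map_ofPlucker_iff (L : Submodule F (Fin 6 → F)) :
    SpannedByDecomposables F (Fin 4 → F) (L.map (ofPlucker F)) ↔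
      Submodule.span F ((L : Set (Fin 6 → F)) ∩ {x | pluckerForm x = 0}) = L := by
  have : ((L.map (ofPlucker F) : Submodule F (ExteriorAlgebra F (Fin 4 → F))) : Set _) ∩
      DecompSet F (Fin 4 → F) =
      ofPlucker F '' ((L : Set (Fin 6 → F)) ∩ {x | pluckerForm x = 0}) := by
    ext y
    constructor
    · rintro ⟨⟨x, hx, rfl⟩, hd⟩
      exact ⟨x, ⟨hx, (ofPlucker_mem_decompSet_iff x).1 hd⟩, rfl⟩
    · rintro ⟨x, ⟨hx, hq⟩, rfl⟩
      exact ⟨⟨x, hx, rfl⟩, (ofPlucker_mem_decompSet_iff x).2 hq⟩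
  rw [SpannedByDecomposables, this, ← Submodule.map_span,
    (Submodule.map_injective_of_injective ofPlucker_injective).eq_iff, eq_comm]

theorem natCard_submodule_grade2 (P : Submodule F (ExteriorAlgebra F (Fin 4 → F)) → Prop) :
    Nat.card {L : Submodule F (ExteriorAlgebra F (Fin 4 → F)) //
      L ≤ grade2 F (Fin 4 → F) ∧ P L} =
    Nat.card {L : Submodule F (Fin 6 → F) // P (L.map (ofPlucker F))} := by
  symm
  refine Nat.card_eq_of_bijective
    (fun L => ⟨L.1.map (ofPlucker F), range_ofPlucker (F := F) ▸ LinearMap.map_le_range, L.2⟩)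
    ⟨fun L M h => Subtype.ext (Submodule.map_injective_of_injective ofPlucker_injective
      (congrArg Subtype.val h)), ?_⟩
  rintro ⟨L, hL, hP⟩
  have : (L.comap (ofPlucker F)).map (ofPlucker F) = L := by
    rw [Submodule.map_comap_eq, range_ofPlucker, inf_eq_right.2 hL]
  exact ⟨⟨L.comap (ofPlucker F), by rwa [this]⟩, Subtype.ext this⟩

end PluckerCoordinates

section CountingPlanes

variable {F V : Type*} [Field F] [Fintype F] [AddCommGroup V] [Module F V] [Finite V]

/-- Double counting of the bases of the planes satisfying `P`. -/
theorem natCard_planes_mul (P : Submodule F V → Prop) :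
    Nat.card {L : Submodule F V // finrank F L = 2 ∧ P L} *
      ((Fintype.card F ^ 2 - 1) * (Fintype.card F ^ 2 - Fintype.card F)) =
    Nat.card {s : Fin 2 → V //
      LinearIndependent F s ∧ P (Submodule.span F (Set.range s))} := by
  have hfib (L : {L : Submodule F V // finrank F L = 2 ∧ P L}) :
      Nat.card {s : Fin 2 → L.1 // LinearIndependent F s} =
        (Fintype.card F ^ 2 - 1) * (Fintype.card F ^ 2 - Fintype.card F) := by
    have : Fintype L.1 := Fintype.ofFinite _
    rw [card_linearIndependent L.2.1.ge, L.2.1, Fin.prod_univ_two]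
    simp
  have span_eq (L : {L : Submodule F V // finrank F L = 2 ∧ P L}) (s : Fin 2 → L.1)
      (hs : LinearIndependent F s) : Submodule.span F (Set.range fun i => (s i : V)) = L := by
    have h := hs.span_eq_top_of_card_eq_finrank' (by simp [L.2.1])
    have := congrArg (Submodule.map L.1.subtype) h
    rwa [Submodule.map_span, ← Set.range_comp, Submodule.map_subtype_top] at this
  have : Fintype {L : Submodule F V // finrank F L = 2 ∧ P L} := Fintype.ofFinite _
  calc
    _ = Nat.card (Σ L : {L : Submodule F V // finrank F L = 2 ∧ P L},
          {s : Fin 2 → L.1 // LinearIndependent F s}) := by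
      rw [Nat.card_sigma]
      simp only [hfib, Finset.sum_const, Finset.card_univ, smul_eq_mul, Nat.card_eq_fintype_card]
    _ = _ := by
      refine Nat.card_eq_of_bijective (fun t => ⟨fun i => t.2.1 i,
        t.2.2.map' t.1.1.subtype (Submodule.ker_subtype _), ?_⟩) ⟨?_, ?_⟩
      · rw [span_eq t.1 t.2.1 t.2.2]
        exact t.1.2.2
      · rintro ⟨L, s, hs⟩ ⟨M, t, ht⟩ h
        have h : (fun i => (s i : V)) = fun i => (t i : V) := congrArg Subtype.val h
        obtain rfl : L = M := by
          apply Subtype.ext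
          rw [← span_eq L s hs, ← span_eq M t ht, h]
        obtain rfl : s = t := funext fun i => Subtype.ext (congrFun h i)
        rfl
      · rintro ⟨s, hs, hP⟩
        refine ⟨⟨⟨Submodule.span F (Set.range s), by simp [finrank_span_eq_card hs], hP⟩,
          fun i => ⟨s i, Submodule.subset_span ⟨i, rfl⟩⟩, ?_⟩, rfl⟩
        exact LinearIndependent.of_comp (Submodule.span F (Set.range s)).subtype hs

theorem natCard_planes (h : 2 ≤ finrank F V) :
    Nat.card {L : Submodule F V // finrank F L = 2} *
      ((Fintype.card F ^ 2 - 1) * (Fintype.card F ^ 2 - Fintype.card F)) =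
    (Fintype.card F ^ finrank F V - 1) * (Fintype.card F ^ finrank F V - Fintype.card F) := by
  have := Fintype.ofFinite V
  have := natCard_planes_mul (F := F) (V := V) fun _ => True
  simp only [and_true] at this
  rw [this, card_linearIndependent h]
  simp [Fin.prod_univ_two]

end CountingPlanes

section PluckerLines

variable {F : Type*} [Field F]

/-- A hyperbolic plane of the Plücker form: it is spanned by two non-orthogonal isotropic
vectors. -/
def IsPluckerHyperbolic (L : Submodule F (Fin 6 → F)) : Prop :=
  ∃ u v, pluckerForm u = 0 ∧ pluckerForm v = 0 ∧ pluckerPolar u v ≠ 0 ∧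
    Submodule.span F {u, v} = L

/-- Pairs of non-orthogonal isotropic vectors of the Plücker form. -/
abbrev IsotropicPair (F : Type*) [Field F] : Type _ :=
  {s : (Fin 6 → F) × (Fin 6 → F) //
    pluckerForm s.1 = 0 ∧ pluckerForm s.2 = 0 ∧ pluckerPolar s.1 s.2 ≠ 0}

theorem pluckerForm_smul (a : F) (x : Fin 6 → F) :
    pluckerForm (a • x) = a ^ 2 * pluckerForm x := by
  simp [pluckerForm]
  ring

theorem pluckerPolar_comm (x y : Fin 6 → F) : pluckerPolar x y = pluckerPolar y x := by
  simp [pluckerPolar]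
  ring

theorem pluckerPolar_smul_smul (a b : F) (x y : Fin 6 → F) :
    pluckerPolar (a • x) (b • y) = a * b * pluckerPolar x y := by
  simp [pluckerPolar]
  ring

theorem pluckerPolar_self (x : Fin 6 → F) : pluckerPolar x x = 2 * pluckerForm x := by
  simp [pluckerForm, pluckerPolar]
  ring

theorem pluckerPolar_add_smul_left (a b : F) (x y z : Fin 6 → F) :
    pluckerPolar (a • x + b • y) z = a * pluckerPolar x z + b * pluckerPolar y z := by
  simp [pluckerPolar]
  ring

theorem linearIndependent_of_pluckerPolar_ne_zero {u v : Fin 6 → F} (hu : pluckerForm u = 0)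
    (hv : pluckerForm v = 0) (h : pluckerPolar u v ≠ 0) : LinearIndependent F ![u, v] := by
  rw [LinearIndependent.pair_iff]
  intro a b hab
  have zero_left (z : Fin 6 → F) : pluckerPolar 0 z = 0 := by simp [pluckerPolar]
  have h1 := pluckerPolar_add_smul_left a b u v u
  have h2 := pluckerPolar_add_smul_left a b u v v
  rw [hab, zero_left, pluckerPolar_self, hu, pluckerPolar_comm v u] at h1
  rw [hab, zero_left, pluckerPolar_self, hv] at h2
  have hb : b = 0 := by simpa [h] using h1.symm
  have ha : a = 0 := by simpa [h] using h2.symm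
  exact ⟨ha, hb⟩

theorem finrank_span_pair_of_pluckerPolar_ne_zero {u v : Fin 6 → F} (hu : pluckerForm u = 0)
    (hv : pluckerForm v = 0) (h : pluckerPolar u v ≠ 0) :
    finrank F (Submodule.span F {u, v}) = 2 := by
  have := finrank_span_eq_card (linearIndependent_of_pluckerPolar_ne_zero hu hv h)
  rwa [Matrix.range_cons_cons_empty, Fintype.card_fin] at this

theorem IsPluckerHyperbolic.finrank_eq {L : Submodule F (Fin 6 → F)}
    (hL : IsPluckerHyperbolic L) : finrank F L = 2 := by
  obtain ⟨u, v, hu, hv, h, rfl⟩ := hL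
  exact finrank_span_pair_of_pluckerPolar_ne_zero hu hv h

theorem IsPluckerHyperbolic.span_isotropic {L : Submodule F (Fin 6 → F)}
    (hL : IsPluckerHyperbolic L) :
    Submodule.span F ((L : Set (Fin 6 → F)) ∩ {x | pluckerForm x = 0}) = L := by
  obtain ⟨u, v, hu, hv, h, rfl⟩ := hL
  refine le_antisymm (Submodule.span_le.2 Set.inter_subset_left) (Submodule.span_mono ?_)
  rintro x (rfl | rfl)
  · exact ⟨Submodule.subset_span (by simp), hu⟩
  · exact ⟨Submodule.subset_span (by simp), hv⟩

/-- A plane spanned by isotropic vectors is hyperbolic or totally isotropic. -/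
theorem isPluckerHyperbolic_or_forall {L : Submodule F (Fin 6 → F)} (hr : finrank F L = 2)
    (hL : Submodule.span F ((L : Set (Fin 6 → F)) ∩ {x | pluckerForm x = 0}) = L) :
    IsPluckerHyperbolic L ∨ ∀ x ∈ L, pluckerForm x = 0 := by
  obtain ⟨f, hf, hspan, -⟩ :=
    Submodule.exists_fun_fin_finrank_span_eq F ((L : Set (Fin 6 → F)) ∩ {x | pluckerForm x = 0})
  have h2 : finrank F (Submodule.span F ((L : Set (Fin 6 → F)) ∩ {x | pluckerForm x = 0})) = 2 := by
    rw [hL, hr]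
  replace hspan := hspan.trans hL
  generalize finrank F (Submodule.span F ((L : Set (Fin 6 → F)) ∩ {x | pluckerForm x = 0})) = m
    at f hf hspan h2
  subst h2
  have hrange : Set.range f = {f 0, f 1} := by
    ext x
    simp [Fin.exists_fin_two, eq_comm]
  rw [hrange] at hspan
  by_cases h : pluckerPolar (f 0) (f 1) = 0
  · right
    intro x hx
    rw [← hspan, Submodule.mem_span_pair] at hx
    obtain ⟨a, b, rfl⟩ := hx
    have h0 : pluckerForm (f 0) = 0 := (hf 0).2
    have h1 : pluckerForm (f 1) = 0 := (hf 1).2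
    rw [pluckerForm_smul_add_smul, h, h0, h1]
    ring
  · exact Or.inl ⟨f 0, f 1, (hf 0).2, (hf 1).2, h, hspan⟩

theorem span_pair_smul_smul {V : Type*} [AddCommGroup V] [Module F V] (a b : Fˣ) (u v : V) :
    Submodule.span F {a • u, b • v} = Submodule.span F {u, v} := by
  rw [Submodule.span_insert, Submodule.span_insert,
    Submodule.span_singleton_group_smul_eq, Submodule.span_singleton_group_smul_eq]

/-- A hyperbolic plane contains exactly `2 (q - 1) ^ 2` non-orthogonal isotropic pairs. -/
theorem natCard_isPluckerHyperbolic_mul :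
    Nat.card {L : Submodule F (Fin 6 → F) // IsPluckerHyperbolic L} * Nat.card (Fˣ × Fˣ × Bool) =
      Nat.card (IsotropicPair F) := by
  rw [← Nat.card_prod]
  choose u v hu hv huv hspan using
    fun L : {L : Submodule F (Fin 6 → F) // IsPluckerHyperbolic L} => L.2
  let pair (t : {L : Submodule F (Fin 6 → F) // IsPluckerHyperbolic L} × Fˣ × Fˣ × Bool) :
      (Fin 6 → F) × (Fin 6 → F) :=
    if t.2.2.2 then (t.2.1 • u t.1, t.2.2.1 • v t.1) else (t.2.1 • v t.1, t.2.2.1 • u t.1)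
  have span_pair (t) : Submodule.span F {(pair t).1, (pair t).2} = t.1.1 := by
    rw [← hspan t.1]
    obtain ⟨L, a, b, i⟩ := t
    cases i
    · exact (span_pair_smul_smul a b _ _).trans (by rw [Set.pair_comm])
    · exact span_pair_smul_smul a b _ _
  have hsmul (a : Fˣ) (x : Fin 6 → F) : a • x = (a : F) • x := rfl
  refine Nat.card_eq_of_bijective (fun t => ⟨pair t, ?_⟩) ⟨?_, ?_⟩
  · obtain ⟨L, a, b, i⟩ := t
    cases i <;>
      simp [pair, hsmul, pluckerForm_smul, pluckerPolar_smul_smul, hu, hv, huv,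
        pluckerPolar_comm (v _) (u _)]
  · rintro ⟨L, a, b, i⟩ ⟨M, c, d, j⟩ h
    have h : pair (L, a, b, i) = pair (M, c, d, j) := congrArg Subtype.val h
    obtain rfl : L = M := by
      apply Subtype.ext
      rw [← span_pair (L, a, b, i), ← span_pair (M, c, d, j), h]
    have hLI (a b : F) (hab : a • u L + b • v L = 0) : a = 0 ∧ b = 0 :=
      (LinearIndependent.pair_iff (x := u L) (y := v L)).1
        (linearIndependent_of_pluckerPolar_ne_zero (hu L) (hv L) (huv L)) a b hab
    have hu0 : u L ≠ 0 := fun h0 => huv L (by simp [h0, pluckerPolar])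
    have hv0 : v L ≠ 0 := fun h0 => huv L (by simp [h0, pluckerPolar])
    have not_parallel (a b : Fˣ) : a • u L ≠ b • v L := by
      intro h
      have := hLI a (-b) (by rw [neg_smul, ← hsmul, ← hsmul, h, add_neg_cancel])
      exact a.ne_zero this.1
    have inj {w : Fin 6 → F} (hw : w ≠ 0) {a b : Fˣ} (h : a • w = b • w) : a = b :=
      Units.ext (smul_left_injective F hw h)
    cases i <;> cases j <;> simp only [pair, if_true, if_false, Prod.mk.injEq,
      Bool.false_eq_true] at h
    · rw [inj hv0 h.1, inj hu0 h.2]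
    · exact absurd h.1.symm (not_parallel _ _)
    · exact absurd h.1 (not_parallel _ _)
    · rw [inj hu0 h.1, inj hv0 h.2]
  · rintro ⟨⟨x, y⟩, hx, hy, hxy⟩
    dsimp only at hx hy hxy
    let L : {L : Submodule F (Fin 6 → F) // IsPluckerHyperbolic L} :=
      ⟨Submodule.span F {x, y}, x, y, hx, hy, hxy, rfl⟩
    have isotropic_mem {z : Fin 6 → F} (hz : z ∈ L.1) (hq : pluckerForm z = 0) (hz0 : z ≠ 0) :
        (∃ a : Fˣ, a • u L = z) ∨ ∃ a : Fˣ, a • v L = z := by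
      rw [← hspan L, Submodule.mem_span_pair] at hz
      obtain ⟨a, b, rfl⟩ := hz
      rw [pluckerForm_smul_add_smul, hu, hv] at hq
      have : a = 0 ∨ b = 0 := by simpa [huv] using hq
      obtain rfl | rfl := this
      · have hb : b ≠ 0 := by rintro rfl; simp at hz0
        exact Or.inr ⟨Units.mk0 b hb, by simp [hsmul]⟩
      · have ha : a ≠ 0 := by rintro rfl; simp at hz0
        exact Or.inl ⟨Units.mk0 a ha, by simp [hsmul]⟩
    have hx0 : x ≠ 0 := fun h0 => hxy (by simp [h0, pluckerPolar])
    have hy0 : y ≠ 0 := fun h0 => hxy (by simp [h0, pluckerPolar])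
    have polar_smul {w : Fin 6 → F} (hw : pluckerForm w = 0) (a b : Fˣ) :
        pluckerPolar (a • w) (b • w) = 0 := by
      rw [hsmul, hsmul, pluckerPolar_smul_smul, pluckerPolar_self, hw]
      ring
    obtain ⟨a, ha⟩ | ⟨a, ha⟩ := isotropic_mem (Submodule.subset_span (by simp)) hx hx0 <;>
    obtain ⟨b, hb⟩ | ⟨b, hb⟩ := isotropic_mem (Submodule.subset_span (by simp)) hy hy0
    · exact absurd (ha ▸ hb ▸ polar_smul (hu L) a b) hxy
    · exact ⟨(L, a, b, true), Subtype.ext (by simp [pair, ha, hb])⟩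
    · exact ⟨(L, a, b, false), Subtype.ext (by simp [pair, ha, hb])⟩
    · exact absurd (ha ▸ hb ▸ polar_smul (hv L) a b) hxy

variable [Fintype F]

theorem natCard_pluckerForm_eq_zero_le :
    Nat.card {x : Fin 6 → F // pluckerForm x = 0} ≤ Fintype.card F ^ 5 + 2 * Fintype.card F ^ 4 := by
  classical
  let g (x : {x : Fin 6 → F // pluckerForm x = 0}) :
      (F × F × F × F × F) ⊕ (F × F × F × F) ⊕ (F × F × F × F) :=
    if x.1 0 ≠ 0 then .inl (x.1 0, x.1 1, x.1 2, x.1 3, x.1 4)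
    else if x.1 1 ≠ 0 then .inr (.inl (x.1 1, x.1 2, x.1 3, x.1 5))
    else .inr (.inr (x.1 2, x.1 3, x.1 4, x.1 5))
  have hg : Function.Injective g := by
    rintro ⟨x, hx⟩ ⟨y, hy⟩ h
    apply Subtype.ext
    simp only [pluckerForm] at hx hy
    simp only [g] at h
    split_ifs at h with h1 h2 h3 h4 h5 h6 <;>
      simp only [Sum.inl.injEq, Sum.inr.injEq, Prod.mk.injEq, reduceCtorEq, not_not] at *
    · obtain ⟨e0, e1, e2, e3, e4⟩ := h
      have e5 : x 5 = y 5 := by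
        rw [e0, e1, e2, e3, e4] at hx
        exact mul_left_cancel₀ h2 (by linear_combination hx - hy)
      ext i
      fin_cases i <;> assumption
    · obtain ⟨e1, e2, e3, e5⟩ := h
      have e0 : x 0 = y 0 := by simp_all
      have e4 : x 4 = y 4 := by
        rw [e0, e1, e2, e3, e5] at hx
        exact mul_left_cancel₀ (e1 ▸ ‹x 1 ≠ 0›) (by linear_combination hy - hx)
      ext i
      fin_cases i <;> assumption
    · obtain ⟨e2, e3, e4, e5⟩ := h
      have e0 : x 0 = y 0 := by simp_all
      have e1 : x 1 = y 1 := by simp_all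
      ext i
      fin_cases i <;> assumption
  refine (Nat.card_le_card_of_injective g hg).trans_eq ?_
  simp only [Nat.card_eq_fintype_card, Fintype.card_sum, Fintype.card_prod]
  ring

theorem natCard_isotropicPair_le :
    Nat.card (IsotropicPair F) ≤ (Fintype.card F ^ 5 + 2 * Fintype.card F ^ 4) ^ 2 := by
  have := Nat.card_le_card_of_injective
    (fun s : IsotropicPair F =>
      ((⟨s.1.1, s.2.1⟩, ⟨s.1.2, s.2.2.1⟩) :
        {x : Fin 6 → F // pluckerForm x = 0} × {x : Fin 6 → F // pluckerForm x = 0}))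
    (fun s t h => Subtype.ext (by simpa [Prod.ext_iff] using h))
  rw [Nat.card_prod, ← sq] at this
  exact this.trans (Nat.pow_le_pow_left natCard_pluckerForm_eq_zero_le 2)

/-- The isotropic vectors `(s, s a, s b, s c, s d, *)` and
`(t, t (a - k), t (b - l), t (c - m), t (d - n), *)` are orthogonal exactly when `k n = l m`. -/
theorem le_natCard_isotropicPair :
    (Fintype.card F - 1) ^ 4 * Fintype.card F ^ 6 ≤ Nat.card (IsotropicPair F) := by
  classical
  let vec (s a b c d : F) : Fin 6 → F := ![s, s * a, s * b, s * c, s * d, s * (a * d - b * c)]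
  have vec_isotropic (s a b c d) : pluckerForm (vec s a b c d) = 0 := by
    simp [pluckerForm, vec]
    ring
  have vec_polar (s t a b c d k l m n) :
      pluckerPolar (vec s a b c d) (vec t (a - k) (b - l) (c - m) (d - n)) =
        s * t * (k * n - l * m) := by
    simp [pluckerPolar, vec]
    ring
  have vec_inj {s a b c d s' a' b' c' d' : F} (hs : s ≠ 0)
      (h : vec s a b c d = vec s' a' b' c' d') : s = s' ∧ a = a' ∧ b = b' ∧ c = c' ∧ d = d' := by
    have h0 : s = s' := congrFun h 0
    subst h0
    exact ⟨rfl, mul_left_cancel₀ hs (congrFun h 1), mul_left_cancel₀ hs (congrFun h 2),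
      mul_left_cancel₀ hs (congrFun h 3), mul_left_cancel₀ hs (congrFun h 4)⟩
  let g (z : (Fˣ × Fˣ × Fˣ × Fˣ) × F × F × F × F × F × F) : IsotropicPair F :=
    let ⟨⟨s, t, k, e⟩, a, b, c, d, l, m⟩ := z
    ⟨(vec s a b c d, vec t (a - k) (b - l) (c - m) (d - (l * m + e) / k)),
      vec_isotropic .., vec_isotropic .., by
        rw [vec_polar, mul_div_cancel₀ _ k.ne_zero, add_sub_cancel_left]
        simp⟩
  have hg : Function.Injective g := by
    rintro ⟨⟨s, t, k, e⟩, a, b, c, d, l, m⟩ ⟨⟨s', t', k', e'⟩, a', b', c', d', l', m'⟩ h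
    have h := Prod.ext_iff.1 (congrArg Subtype.val h)
    obtain ⟨hs, rfl, rfl, rfl, rfl⟩ := vec_inj s.ne_zero h.1
    obtain ⟨ht, hk, hl, hm, hn⟩ := vec_inj t.ne_zero h.2
    obtain rfl := Units.ext hs
    obtain rfl := Units.ext ht
    obtain rfl := Units.ext (sub_right_injective hk)
    obtain rfl := sub_right_injective hl
    obtain rfl := sub_right_injective hm
    have hn := sub_right_injective hn
    rw [div_left_inj' k.ne_zero, add_right_inj] at hn
    rw [Units.ext hn]
  refine le_of_eq_of_le ?_ (Nat.card_le_card_of_injective g hg)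
  simp only [Nat.card_eq_fintype_card, Fintype.card_prod, Fintype.card_units]
  ring

theorem natCard_totally_isotropic_mul_le :
    Nat.card {L : Submodule F (Fin 6 → F) // finrank F L = 2 ∧ ∀ x ∈ L, pluckerForm x = 0} *
      ((Fintype.card F ^ 2 - 1) * (Fintype.card F ^ 2 - Fintype.card F)) ≤
    (Fintype.card F ^ 5 + 2 * Fintype.card F ^ 4) ^ 2 := by
  rw [natCard_planes_mul fun L : Submodule F (Fin 6 → F) => ∀ x ∈ L, pluckerForm x = 0]
  refine le_trans ?_ (Nat.pow_le_pow_left natCard_pluckerForm_eq_zero_le 2)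
  have := Nat.card_le_card_of_injective
    (β := Fin 2 → {x : Fin 6 → F // pluckerForm x = 0})
    (fun s : {s : Fin 2 → (Fin 6 → F) // LinearIndependent F s ∧
        ∀ x ∈ Submodule.span F (Set.range s), pluckerForm x = 0} =>
      fun i => ⟨s.1 i, s.2.2 _ (Submodule.subset_span ⟨i, rfl⟩)⟩)
    (fun s t h => Subtype.ext (funext fun i => congrArg Subtype.val (congrFun h i)))
  simpa [Nat.card_fun] using this

end PluckerLines

section Proportion

theorem finrank_map_ofPlucker {F : Type*} [Field F] (L : Submodule F (Fin 6 → F)) :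
    finrank F (L.map (ofPlucker F)) = finrank F L :=
  (Submodule.equivMapOfInjective _ ofPlucker_injective L).finrank_eq.symm

variable (p : ℕ) [Fact p.Prime]

theorem numAll_four_two_mul :
    numAll p 4 2 * ((p ^ 2 - 1) * (p ^ 2 - p)) = (p ^ 6 - 1) * (p ^ 6 - p) := by
  have h := natCard_planes (F := ZMod p) (V := Fin 6 → ZMod p) (by simp)
  rw [numAll, natCard_submodule_grade2 (fun L => finrank (ZMod p) L = 2)]
  simpa only [finrank_map_ofPlucker, ZMod.card, finrank_fin_fun] using h

theorem numSpanned_four_two : numSpanned p 4 2 =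
    Nat.card {L : Submodule (ZMod p) (Fin 6 → ZMod p) // finrank (ZMod p) L = 2 ∧
      Submodule.span (ZMod p) ((L : Set (Fin 6 → ZMod p)) ∩ {x | pluckerForm x = 0}) = L} := by
  rw [numSpanned, natCard_submodule_grade2 (fun L => finrank (ZMod p) L = 2 ∧
    SpannedByDecomposables (ZMod p) (Fin 4 → ZMod p) L)]
  simp only [finrank_map_ofPlucker, spannedByDecomposables_map_ofPlucker_iff]

theorem le_numSpanned_four_two :
    Nat.card {L : Submodule (ZMod p) (Fin 6 → ZMod p) // IsPluckerHyperbolic L} ≤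
      numSpanned p 4 2 := by
  rw [numSpanned_four_two]
  exact Nat.card_le_card_of_injective _
    (Subtype.impEmbedding _ _ fun L hL => ⟨hL.finrank_eq, hL.span_isotropic⟩).injective

theorem numSpanned_four_two_le : numSpanned p 4 2 ≤
    Nat.card {L : Submodule (ZMod p) (Fin 6 → ZMod p) // IsPluckerHyperbolic L} +
      Nat.card {L : Submodule (ZMod p) (Fin 6 → ZMod p) //
        finrank (ZMod p) L = 2 ∧ ∀ x ∈ L, pluckerForm x = 0} := by
  rw [numSpanned_four_two]
  refine le_trans (Set.ncard_le_ncard (t := {L | IsPluckerHyperbolic L} ∪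
    {L | finrank (ZMod p) L = 2 ∧ ∀ x ∈ L, pluckerForm x = 0}) ?_ (Set.toFinite _))
    (Set.ncard_union_le _ _)
  rintro L ⟨hr, hL⟩
  exact (isPluckerHyperbolic_or_forall hr hL).imp_right fun h => ⟨hr, h⟩

/-- `p ^ 8 / numAll p 4 2` as a function of `t = 1 / p`. -/
def planeDensity (t : ℝ) : ℝ := (1 - t ^ 2) * (1 - t) / ((1 - t ^ 6) * (1 - t ^ 5))

theorem natCard_isPluckerHyperbolic_zmod_mul :
    (Nat.card {L : Submodule (ZMod p) (Fin 6 → ZMod p) // IsPluckerHyperbolic L} : ℝ) *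
      (2 * ((p : ℝ) - 1) ^ 2) = Nat.card (IsotropicPair (ZMod p)) := by
  have h := natCard_isPluckerHyperbolic_mul (F := ZMod p)
  have hp := (Fact.out : p.Prime).one_le
  have hu : Fintype.card (ZMod p)ˣ = p - 1 := by rw [Fintype.card_units, ZMod.card]
  simp only [Nat.card_prod, Nat.card_eq_fintype_card (α := Bool),
    Nat.card_eq_fintype_card (α := (ZMod p)ˣ), hu, Fintype.card_bool] at h
  rw [← h]
  push_cast [hp]
  ring

theorem decompRatio_four_two_bounds :
    (1 - (p : ℝ)⁻¹) ^ 2 / 2 * planeDensity (p : ℝ)⁻¹ ≤ decompRatio p 4 2 ∧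
    decompRatio p 4 2 ≤ ((1 + 2 * (p : ℝ)⁻¹) ^ 2 / (2 * (1 - (p : ℝ)⁻¹) ^ 2) +
      (p : ℝ)⁻¹ ^ 2 * (1 + 2 * (p : ℝ)⁻¹) ^ 2 / ((1 - (p : ℝ)⁻¹ ^ 2) * (1 - (p : ℝ)⁻¹))) *
      planeDensity (p : ℝ)⁻¹ := by
  have hp := (Fact.out : p.Prime).one_lt
  have hN := numAll_four_two_mul p
  have hT := natCard_totally_isotropic_mul_le (F := ZMod p)
  have hG₁ := le_natCard_isotropicPair (F := ZMod p)
  have hG₂ := natCard_isotropicPair_le (F := ZMod p)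
  have hH := natCard_isPluckerHyperbolic_zmod_mul p
  have hS₁ := le_numSpanned_four_two p
  have hS₂ := numSpanned_four_two_le p
  rw [ZMod.card] at hT hG₁ hG₂
  unfold decompRatio
  generalize numAll p 4 2 = N at *
  generalize numSpanned p 4 2 = S at *
  generalize Nat.card {L : Submodule (ZMod p) (Fin 6 → ZMod p) // IsPluckerHyperbolic L} = H at *
  generalize Nat.card {L : Submodule (ZMod p) (Fin 6 → ZMod p) //
    finrank (ZMod p) L = 2 ∧ ∀ x ∈ L, pluckerForm x = 0} = T at *
  generalize Nat.card (IsotropicPair (ZMod p)) = G at *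
  have c (k : ℕ) : 1 ≤ p ^ k := Nat.one_le_pow _ _ hp.le
  have c' (k : ℕ) (hk : k ≠ 0) : p ≤ p ^ k := Nat.le_self_pow hk p
  replace hN := congrArg (Nat.cast (R := ℝ)) hN
  replace hT := Nat.cast_le (α := ℝ).2 hT
  replace hG₁ := Nat.cast_le (α := ℝ).2 hG₁
  replace hG₂ := Nat.cast_le (α := ℝ).2 hG₂
  replace hS₁ := Nat.cast_le (α := ℝ).2 hS₁
  replace hS₂ := Nat.cast_le (α := ℝ).2 hS₂
  have hx : (1 : ℝ) < p := by exact_mod_cast hp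
  push_cast [c, c' 2 two_ne_zero, c' 6 (by decide), hp.le] at hN hT hG₁ hG₂ hS₂
  generalize (p : ℝ) = x at *
  obtain ⟨t, rfl⟩ : ∃ t : ℝ, x = t⁻¹ := ⟨x⁻¹, (inv_inv x).symm⟩
  rw [inv_inv]
  have ht0 : 0 < t := by
    rw [← inv_pos]
    linarith
  have ht1 : t < 1 := (one_lt_inv₀ ht0).1 hx
  have one_sub_pos (k : ℕ) (hk : k ≠ 0) : 0 < 1 - t ^ k :=
    sub_pos.2 (pow_lt_one₀ ht0.le ht1 hk)
  have d1 : 0 < 1 - t := sub_pos.2 ht1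
  have d2 := one_sub_pos 2 (by decide)
  have d5 := one_sub_pos 5 (by decide)
  have d6 := one_sub_pos 6 (by decide)
  have hN' : (N : ℝ) = (1 - t ^ 6) * (1 - t ^ 5) / ((1 - t ^ 2) * (1 - t)) / t ^ 8 := by
    field_simp at hN ⊢
    linear_combination hN
  have hH' : (H : ℝ) = G * t ^ 2 / (2 * (1 - t) ^ 2) := by
    rw [← hH]
    field_simp
  have hH₁ : (1 - t) ^ 2 / 2 / t ^ 8 ≤ H := by
    calc _ = (t⁻¹ - 1) ^ 4 * t⁻¹ ^ 6 * t ^ 2 / (2 * (1 - t) ^ 2) := by field_simp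
      _ ≤ _ := by rw [hH']; gcongr
  have hH₂ : (H : ℝ) ≤ (1 + 2 * t) ^ 2 / (2 * (1 - t) ^ 2) / t ^ 8 := by
    calc _ ≤ (t⁻¹ ^ 5 + 2 * t⁻¹ ^ 4) ^ 2 * t ^ 2 / (2 * (1 - t) ^ 2) := by rw [hH']; gcongr
      _ = _ := by field_simp
  have hT₂ : (T : ℝ) ≤ t ^ 2 * (1 + 2 * t) ^ 2 / ((1 - t ^ 2) * (1 - t)) / t ^ 8 := by
    calc (T : ℝ) = T * ((t⁻¹ ^ 2 - 1) * (t⁻¹ ^ 2 - t⁻¹)) * (t ^ 4 / ((1 - t ^ 2) * (1 - t))) := by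
          field_simp
      _ ≤ (t⁻¹ ^ 5 + 2 * t⁻¹ ^ 4) ^ 2 * (t ^ 4 / ((1 - t ^ 2) * (1 - t))) := by gcongr
      _ = _ := by field_simp
  have key (y : ℝ) : y * planeDensity t = y / t ^ 8 / N := by
    rw [hN', planeDensity]
    field_simp
  rw [key, key]
  constructor
  · gcongr
    exact hH₁.trans hS₁
  · gcongr
    rw [add_div]
    linarith

end Proportion

/-- the limit over primes `p → ∞` of the proportion of 2-dimensional
subspaces of `⋀²(F_p^4)` spanned by decomposables equals `1/2`. -/
theorem stmt7 :
    Tendsto (fun p : ℕ => decompRatio p 4 2) primesAtTop (nhds (1 / 2 : ℝ)) := by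
  have hinv : Tendsto (fun p : ℕ => (p : ℝ)⁻¹) primesAtTop (nhds 0) :=
    tendsto_inv_atTop_nhds_zero_nat.mono_left inf_le_left
  have hprime : ∀ᶠ p in primesAtTop, p.Prime := mem_inf_of_right (mem_principal_self _)
  have lower : ContinuousAt (fun t : ℝ => (1 - t) ^ 2 / 2 * planeDensity t) 0 := by
    unfold planeDensity
    fun_prop (disch := norm_num)
  have upper : ContinuousAt (fun t : ℝ => ((1 + 2 * t) ^ 2 / (2 * (1 - t) ^ 2) +
      t ^ 2 * (1 + 2 * t) ^ 2 / ((1 - t ^ 2) * (1 - t))) * planeDensity t) 0 := by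
    unfold planeDensity
    fun_prop (disch := norm_num)
  have hl := lower.tendsto.comp hinv
  have hu := upper.tendsto.comp hinv
  norm_num [planeDensity] at hl hu
  refine tendsto_of_tendsto_of_tendsto_of_le_of_le' (by simpa using hl) (by simpa using hu)
    (hprime.mono fun p hp => ?_) (hprime.mono fun p hp => ?_)
  · have := Fact.mk hp
    exact (decompRatio_four_two_bounds p).1
  · have := Fact.mk hp
    exact (decompRatio_four_two_bounds p).2

end
end
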